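/- Given a finite Kripke structure M and a PLTL formula ψ, M ⊨ ψ (every initialised infinite path of M satisfies ψ) if and only if there exists k ≥ 0 such that the completeness formula conjoined with the simple path formula, ⟦⟦M,¬ψ,k⟧⟧ ∧ ⟦SimplePath⟧_k, is unsatisfiable and the witness formula conjoined with the simple path formula, ⟦M,¬ψ,i⟧ ∧ ⟦SimplePath⟧_i, is unsatisfiable for all 0 ≤ i < k. -/

import Mathlib

namespace BMC

/-- PLTL formulas in positive normal form: literals `p`, `¬p`, conjunction,
disjunction, next `X`, until `U`, release `R`, previous `Y`, weak previous `Z`,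
since `S` and trigger `T`. -/
inductive PLTL (AP : Type) : Type
  | atom  : AP → PLTL AP
  | natom : AP → PLTL AP
  | conj  : PLTL AP → PLTL AP → PLTL AP
  | disj  : PLTL AP → PLTL AP → PLTL AP
  | next  : PLTL AP → PLTL AP
  | untl  : PLTL AP → PLTL AP → PLTL AP
  | rels  : PLTL AP → PLTL AP → PLTL AP
  | prev  : PLTL AP → PLTL AP
  | wprev : PLTL AP → PLTL AP
  | since : PLTL AP → PLTL AP → PLTL AP
  | trig  : PLTL AP → PLTL AP → PLTL AP

variable {AP S : Type}

/-- Standard PLTL semantics `π^i ⊨ φ` on an infinite sequence of states `π`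
with labelling `L`. -/
def PLTL.sat (L : S → Set AP) (π : ℕ → S) : PLTL AP → ℕ → Prop
  | .atom p, i => p ∈ L (π i)
  | .natom p, i => p ∉ L (π i)
  | .conj f g, i => PLTL.sat L π f i ∧ PLTL.sat L π g i
  | .disj f g, i => PLTL.sat L π f i ∨ PLTL.sat L π g i
  | .next f, i => PLTL.sat L π f (i + 1)
  | .untl f g, i => ∃ j, i ≤ j ∧ PLTL.sat L π g j ∧ ∀ n, i ≤ n → n < j → PLTL.sat L π f n
  | .rels f g, i => ∀ j, i ≤ j → (PLTL.sat L π g j ∨ ∃ n, i ≤ n ∧ n < j ∧ PLTL.sat L π f n)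
  | .prev f, i => 0 < i ∧ PLTL.sat L π f (i - 1)
  | .wprev f, i => i = 0 ∨ PLTL.sat L π f (i - 1)
  | .since f g, i => ∃ j, j ≤ i ∧ PLTL.sat L π g j ∧ ∀ n, j < n → n ≤ i → PLTL.sat L π f n
  | .trig f g, i => ∀ j, j ≤ i → (PLTL.sat L π g j ∨ ∃ n, j < n ∧ n ≤ i ∧ PLTL.sat L π f n)

/-- The no-loop bounded semantics `π^i ⊨_nl φ` with bound `k`: future operators
are restricted to positions `≤ k`. -/
def PLTL.satNL (L : S → Set AP) (π : ℕ → S) (k : ℕ) : PLTL AP → ℕ → Prop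
  | .atom p, i => p ∈ L (π i)
  | .natom p, i => p ∉ L (π i)
  | .conj f g, i => PLTL.satNL L π k f i ∧ PLTL.satNL L π k g i
  | .disj f g, i => PLTL.satNL L π k f i ∨ PLTL.satNL L π k g i
  | .next f, i => i < k ∧ PLTL.satNL L π k f (i + 1)
  | .untl f g, i => ∃ j, i ≤ j ∧ j ≤ k ∧ PLTL.satNL L π k g j ∧
      ∀ n, i ≤ n → n < j → PLTL.satNL L π k f n
  | .rels f g, i => ∃ j, i ≤ j ∧ j ≤ k ∧ PLTL.satNL L π k f j ∧
      ∀ n, i ≤ n → n ≤ j → PLTL.satNL L π k g n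
  | .prev f, i => 0 < i ∧ PLTL.satNL L π k f (i - 1)
  | .wprev f, i => i = 0 ∨ PLTL.satNL L π k f (i - 1)
  | .since f g, i => ∃ j, j ≤ i ∧ PLTL.satNL L π k g j ∧
      ∀ n, j < n → n ≤ i → PLTL.satNL L π k f n
  | .trig f g, i => ∀ j, j ≤ i → (PLTL.satNL L π k g j ∨
      ∃ n, j < n ∧ n ≤ i ∧ PLTL.satNL L π k f n)

/-- `π` is a (k,l)-loop: `0 < l ≤ k`, `π (l-1) = π k`, and from position `l`
onwards `π` is periodic with period `p = k + 1 - l`. -/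
def IsKLoop (π : ℕ → S) (k l : ℕ) : Prop :=
  0 < l ∧ l ≤ k ∧ π (l - 1) = π k ∧ ∀ i, l ≤ i → π (i + (k + 1 - l)) = π i

/-- The bounded semantics `π ⊨_k φ`. -/
def PLTL.bsat (L : S → Set AP) (π : ℕ → S) (k : ℕ) (φ : PLTL AP) : Prop :=
  (∃ l, IsKLoop π k l ∧ PLTL.sat L π φ 0) ∨ PLTL.satNL L π k φ 0

/-- The past operator depth `δ`. -/
def PLTL.delta : PLTL AP → ℕ
  | .atom _ => 0
  | .natom _ => 0
  | .conj f g => max f.delta g.delta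
  | .disj f g => max f.delta g.delta
  | .next f => f.delta
  | .untl f g => max f.delta g.delta
  | .rels f g => max f.delta g.delta
  | .prev f => f.delta + 1
  | .wprev f => f.delta + 1
  | .since f g => max f.delta g.delta + 1
  | .trig f g => max f.delta g.delta + 1

/-- A Kripke structure over state space `S` and atomic propositions `AP`. -/
structure Kripke (S AP : Type) where
  T : S → S → Prop
  I : S → Prop
  L : S → Set AP

/-- The transition relation is total. -/
def Kripke.Total (M : Kripke S AP) : Prop := ∀ s, ∃ s', M.T s s'

/-- An initialised infinite path of `M`. -/
def Kripke.InitPath (M : Kripke S AP) (π : ℕ → S) : Prop :=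
  M.I (π 0) ∧ ∀ i, M.T (π i) (π (i + 1))

end BMC
namespace BMC

variable {AP S : Type}

/-- Model constraints `⟦M⟧_k = I(s_0) ∧ ⋀_{i=1}^k T(s_{i-1}, s_i)`. -/
def ModelC (M : Kripke S AP) (k : ℕ) (s : ℕ → S) : Prop :=
  M.I (s 0) ∧ ∀ i, 1 ≤ i → i ≤ k → M.T (s (i - 1)) (s i)

/-- Loop constraints `⟦LoopConstraints⟧_k`. -/
def LoopC (k : ℕ) (s : ℕ → S) (lsel inL : ℕ → Prop) (LE : Prop) : Prop :=
  ¬ lsel 0 ∧ ¬ inL 0 ∧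
  (∀ i, 1 ≤ i → i ≤ k → (lsel i → s (i - 1) = s k)) ∧
  (∀ i, 1 ≤ i → i ≤ k → (inL i ↔ (inL (i - 1) ∨ lsel i))) ∧
  (∀ i, 1 ≤ i → i ≤ k → (inL (i - 1) → ¬ lsel i)) ∧
  (LE ↔ inL k)

end BMC
namespace BMC

variable {AP S : Type}

/-- Lookup of the virtually unrolled formula variable `⟦φ⟧^d_i`, using the
convention `⟦φ⟧^d_i = ⟦φ⟧^{δ(φ)}_i` when `d > δ(φ)`. -/
def pV (v : PLTL AP → ℕ → ℕ → Prop) (φ : PLTL AP) (d i : ℕ) : Prop :=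
  v φ (min d φ.delta) i

/-- `⟦LastStateFormula⟧_k` constraints for one subformula `φ` of the PLTL
eventuality encoding. -/
def pLastC (k : ℕ) (lsel : ℕ → Prop) (LE : Prop)
    (v : PLTL AP → ℕ → ℕ → Prop) (φ : PLTL AP) : Prop :=
  ∀ d, d ≤ φ.delta →
    (¬ LE → ¬ v φ d (k + 1)) ∧
    (∀ i, 1 ≤ i → i ≤ k → lsel i → (v φ d (k + 1) ↔ pV v φ (d + 1) i))

/-- The constraints `⟦EventualityPLTL⟧_k` (together with the
`⟦LastStateFormula⟧_k` constraints) of the PLTL eventuality encoding,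
generated for a formula and, recursively, all of its subformulas.
`v φ d i` is the formula variable `⟦φ⟧^d_i` and `aux φ i` the auxiliary
variable `⟨⟨Fψ2⟩⟩^{δ(ψ2)}_i` (for until subformulas `φ = ψ1 U ψ2`)
resp. `⟨⟨Gψ2⟩⟩^{δ(ψ2)}_i` (for release subformulas). -/
def pevC (k : ℕ) (L : S → Set AP) (s : ℕ → S) (lsel inL : ℕ → Prop)
    (LE : Prop) (v : PLTL AP → ℕ → ℕ → Prop) (aux : PLTL AP → ℕ → Prop) :
    PLTL AP → Prop
  | .atom p =>
      (∀ i, i ≤ k → (v (.atom p) 0 i ↔ p ∈ L (s i))) ∧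
      pLastC k lsel LE v (.atom p)
  | .natom p =>
      (∀ i, i ≤ k → (v (.natom p) 0 i ↔ p ∉ L (s i))) ∧
      pLastC k lsel LE v (.natom p)
  | .conj f g =>
      pevC k L s lsel inL LE v aux f ∧ pevC k L s lsel inL LE v aux g ∧
      (∀ d, d ≤ (PLTL.conj f g).delta → ∀ i, i ≤ k →
        (v (.conj f g) d i ↔ (pV v f d i ∧ pV v g d i))) ∧
      pLastC k lsel LE v (.conj f g)
  | .disj f g =>
      pevC k L s lsel inL LE v aux f ∧ pevC k L s lsel inL LE v aux g ∧
      (∀ d, d ≤ (PLTL.disj f g).delta → ∀ i, i ≤ k →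
        (v (.disj f g) d i ↔ (pV v f d i ∨ pV v g d i))) ∧
      pLastC k lsel LE v (.disj f g)
  | .next f =>
      pevC k L s lsel inL LE v aux f ∧
      (∀ d, d ≤ (PLTL.next f).delta → ∀ i, i ≤ k →
        (v (.next f) d i ↔ pV v f d (i + 1))) ∧
      pLastC k lsel LE v (.next f)
  | .untl f g =>
      pevC k L s lsel inL LE v aux f ∧ pevC k L s lsel inL LE v aux g ∧
      (∀ d, d ≤ (PLTL.untl f g).delta → ∀ i, i ≤ k →
        (v (.untl f g) d i ↔
          (pV v g d i ∨ (pV v f d i ∧ v (.untl f g) d (i + 1))))) ∧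
      pLastC k lsel LE v (.untl f g) ∧
      (¬ aux (.untl f g) 0) ∧
      (∀ i, 1 ≤ i → i ≤ k →
        (aux (.untl f g) i ↔
          (aux (.untl f g) (i - 1) ∨ (inL i ∧ v g g.delta i)))) ∧
      (LE → v (.untl f g) (PLTL.untl f g).delta k → aux (.untl f g) k)
  | .rels f g =>
      pevC k L s lsel inL LE v aux f ∧ pevC k L s lsel inL LE v aux g ∧
      (∀ d, d ≤ (PLTL.rels f g).delta → ∀ i, i ≤ k →
        (v (.rels f g) d i ↔
          (pV v g d i ∧ (pV v f d i ∨ v (.rels f g) d (i + 1))))) ∧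
      pLastC k lsel LE v (.rels f g) ∧
      (aux (.rels f g) 0) ∧
      (∀ i, 1 ≤ i → i ≤ k →
        (aux (.rels f g) i ↔
          (aux (.rels f g) (i - 1) ∧ (¬ inL i ∨ v g g.delta i)))) ∧
      (LE → aux (.rels f g) k → v (.rels f g) (PLTL.rels f g).delta k)
  | .prev f =>
      pevC k L s lsel inL LE v aux f ∧
      (∀ d, d ≤ (PLTL.prev f).delta → ¬ v (.prev f) d 0) ∧
      (∀ i, 1 ≤ i → i ≤ k → (v (.prev f) 0 i ↔ pV v f 0 (i - 1))) ∧
      (∀ d, 1 ≤ d → d ≤ (PLTL.prev f).delta → ∀ i, 1 ≤ i → i ≤ k →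
        (v (.prev f) d i ↔
          ((lsel i ∧ pV v f (d - 1) k) ∨ (¬ lsel i ∧ pV v f d (i - 1))))) ∧
      pLastC k lsel LE v (.prev f)
  | .wprev f =>
      pevC k L s lsel inL LE v aux f ∧
      (∀ d, d ≤ (PLTL.wprev f).delta → v (.wprev f) d 0) ∧
      (∀ i, 1 ≤ i → i ≤ k → (v (.wprev f) 0 i ↔ pV v f 0 (i - 1))) ∧
      (∀ d, 1 ≤ d → d ≤ (PLTL.wprev f).delta → ∀ i, 1 ≤ i → i ≤ k →
        (v (.wprev f) d i ↔
          ((lsel i ∧ pV v f (d - 1) k) ∨ (¬ lsel i ∧ pV v f d (i - 1))))) ∧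
      pLastC k lsel LE v (.wprev f)
  | .since f g =>
      pevC k L s lsel inL LE v aux f ∧ pevC k L s lsel inL LE v aux g ∧
      (∀ d, d ≤ (PLTL.since f g).delta → (v (.since f g) d 0 ↔ pV v g d 0)) ∧
      (∀ i, 1 ≤ i → i ≤ k →
        (v (.since f g) 0 i ↔
          (pV v g 0 i ∨ (pV v f 0 i ∧ v (.since f g) 0 (i - 1))))) ∧
      (∀ d, 1 ≤ d → d ≤ (PLTL.since f g).delta → ∀ i, 1 ≤ i → i ≤ k →
        (v (.since f g) d i ↔
          (pV v g d i ∨ (pV v f d i ∧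
            ((lsel i ∧ v (.since f g) (d - 1) k) ∨
             (¬ lsel i ∧ v (.since f g) d (i - 1))))))) ∧
      pLastC k lsel LE v (.since f g)
  | .trig f g =>
      pevC k L s lsel inL LE v aux f ∧ pevC k L s lsel inL LE v aux g ∧
      (∀ d, d ≤ (PLTL.trig f g).delta → (v (.trig f g) d 0 ↔ pV v g d 0)) ∧
      (∀ i, 1 ≤ i → i ≤ k →
        (v (.trig f g) 0 i ↔
          (pV v g 0 i ∧ (pV v f 0 i ∨ v (.trig f g) 0 (i - 1))))) ∧
      (∀ d, 1 ≤ d → d ≤ (PLTL.trig f g).delta → ∀ i, 1 ≤ i → i ≤ k →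
        (v (.trig f g) d i ↔
          (pV v g d i ∧ (pV v f d i ∨
            ((lsel i ∧ v (.trig f g) (d - 1) k) ∨
             (¬ lsel i ∧ v (.trig f g) d (i - 1))))))) ∧
      pLastC k lsel LE v (.trig f g)

/-- Satisfiability of the PLTL eventuality encoding
`⟦M,ψ,k⟧ = ⟦M⟧_k ∧ ⟦LoopConstraints⟧_k ∧ ⟦LastStateFormula⟧_k ∧
⟦EventualityPLTL⟧_k ∧ ⟦ψ⟧^0_0`. -/
def PEvSat (M : Kripke S AP) (ψ : PLTL AP) (k : ℕ) : Prop :=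
  ∃ (s : ℕ → S) (lsel inL : ℕ → Prop) (LE : Prop)
    (v : PLTL AP → ℕ → ℕ → Prop) (aux : PLTL AP → ℕ → Prop),
    ModelC M k s ∧ LoopC k s lsel inL LE ∧
    pevC k M.L s lsel inL LE v aux ψ ∧ v ψ 0 0

end BMC
namespace BMC

variable {AP S : Type}

/-- Lookup of a proxy formula variable (at index `E` or `L`) with the
convention that unrollings beyond `δ(φ)` are identified with `δ(φ)`. -/
def pW (w : PLTL AP → ℕ → Prop) (φ : PLTL AP) (d : ℕ) : Prop :=
  w φ (min d φ.delta)

/-- Loop constraints of the incremental PLTL eventuality encoding, using the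
proxy state `sE`; the flag `dep` controls whether the `k`-dependent
constraints (`s_E = s_k` and `LoopExists ⇔ InLoop_k`) are included. -/
def incLoopC (dep : Bool) (k : ℕ) (s : ℕ → S) (sE : S)
    (lsel inL : ℕ → Prop) (LE : Prop) : Prop :=
  ¬ lsel 0 ∧ ¬ inL 0 ∧
  (∀ i, 1 ≤ i → i ≤ k → (lsel i → s (i - 1) = sE)) ∧
  (∀ i, 1 ≤ i → i ≤ k → (inL i ↔ (inL (i - 1) ∨ lsel i))) ∧
  (∀ i, 1 ≤ i → i ≤ k → (inL (i - 1) → ¬ lsel i)) ∧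
  (dep = true → (LE ↔ inL k)) ∧
  (dep = true → sE = s k)

/-- The `⟦LastStateFormula⟧_k` constraints of the incremental encoding for one
subformula `φ`, with proxy variables `⟦φ⟧^d_L` and `⟦φ⟧^d_E`; the flag `dep`
controls the `k`-dependent constraints `⟦φ⟧^d_E ⇔ ⟦φ⟧^d_k` and
`⟦φ⟧^d_{k+1} ⇔ ⟦φ⟧^{min(d+1,δ(φ))}_L`. -/
def incLastC (dep : Bool) (k : ℕ) (lsel : ℕ → Prop) (LE : Prop)
    (v : PLTL AP → ℕ → ℕ → Prop) (vE vL : PLTL AP → ℕ → Prop)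
    (φ : PLTL AP) : Prop :=
  ∀ d, d ≤ φ.delta →
    (¬ LE → ¬ vL φ d) ∧
    (∀ i, 1 ≤ i → i ≤ k → lsel i → (vL φ d ↔ v φ d i)) ∧
    (dep = true → (vE φ d ↔ v φ d k)) ∧
    (dep = true → (v φ d (k + 1) ↔ pW vL φ (d + 1)))

/-- The constraints `⟦IncPLTL⟧_k` (together with `⟦LastStateFormula⟧_k`) of
the incremental PLTL eventuality encoding, generated recursively for all
subformulas.  `v φ d i` are the formula variables, `vE`/`vL` the proxy
variables at the proxy indices `E` resp. `L`, `aux φ i` the auxiliary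
variables and `auxE φ` their proxies at index `E`; the flag `dep` controls
whether the `k`-dependent constraints are included. -/
def pincC (dep : Bool) (k : ℕ) (L : S → Set AP) (s : ℕ → S)
    (lsel inL : ℕ → Prop) (LE : Prop) (v : PLTL AP → ℕ → ℕ → Prop)
    (vE vL : PLTL AP → ℕ → Prop) (aux : PLTL AP → ℕ → Prop)
    (auxE : PLTL AP → Prop) : PLTL AP → Prop
  | .atom p =>
      (∀ i, i ≤ k → (v (.atom p) 0 i ↔ p ∈ L (s i))) ∧
      incLastC dep k lsel LE v vE vL (.atom p)
  | .natom p =>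
      (∀ i, i ≤ k → (v (.natom p) 0 i ↔ p ∉ L (s i))) ∧
      incLastC dep k lsel LE v vE vL (.natom p)
  | .conj f g =>
      pincC dep k L s lsel inL LE v vE vL aux auxE f ∧
      pincC dep k L s lsel inL LE v vE vL aux auxE g ∧
      (∀ d, d ≤ (PLTL.conj f g).delta → ∀ i, i ≤ k →
        (v (.conj f g) d i ↔ (pV v f d i ∧ pV v g d i))) ∧
      incLastC dep k lsel LE v vE vL (.conj f g)
  | .disj f g =>
      pincC dep k L s lsel inL LE v vE vL aux auxE f ∧
      pincC dep k L s lsel inL LE v vE vL aux auxE g ∧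
      (∀ d, d ≤ (PLTL.disj f g).delta → ∀ i, i ≤ k →
        (v (.disj f g) d i ↔ (pV v f d i ∨ pV v g d i))) ∧
      incLastC dep k lsel LE v vE vL (.disj f g)
  | .next f =>
      pincC dep k L s lsel inL LE v vE vL aux auxE f ∧
      (∀ d, d ≤ (PLTL.next f).delta → ∀ i, i ≤ k →
        (v (.next f) d i ↔ pV v f d (i + 1))) ∧
      incLastC dep k lsel LE v vE vL (.next f)
  | .untl f g =>
      pincC dep k L s lsel inL LE v vE vL aux auxE f ∧
      pincC dep k L s lsel inL LE v vE vL aux auxE g ∧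
      (∀ d, d ≤ (PLTL.untl f g).delta → ∀ i, i ≤ k →
        (v (.untl f g) d i ↔
          (pV v g d i ∨ (pV v f d i ∧ v (.untl f g) d (i + 1))))) ∧
      incLastC dep k lsel LE v vE vL (.untl f g) ∧
      (¬ aux (.untl f g) 0) ∧
      (∀ i, 1 ≤ i → i ≤ k →
        (aux (.untl f g) i ↔
          (aux (.untl f g) (i - 1) ∨ (inL i ∧ v g g.delta i)))) ∧
      (LE → vE (.untl f g) (PLTL.untl f g).delta → auxE (.untl f g)) ∧
      (dep = true → (auxE (.untl f g) ↔ aux (.untl f g) k))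
  | .rels f g =>
      pincC dep k L s lsel inL LE v vE vL aux auxE f ∧
      pincC dep k L s lsel inL LE v vE vL aux auxE g ∧
      (∀ d, d ≤ (PLTL.rels f g).delta → ∀ i, i ≤ k →
        (v (.rels f g) d i ↔
          (pV v g d i ∧ (pV v f d i ∨ v (.rels f g) d (i + 1))))) ∧
      incLastC dep k lsel LE v vE vL (.rels f g) ∧
      (aux (.rels f g) 0) ∧
      (∀ i, 1 ≤ i → i ≤ k →
        (aux (.rels f g) i ↔
          (aux (.rels f g) (i - 1) ∧ (¬ inL i ∨ v g g.delta i)))) ∧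
      (LE → auxE (.rels f g) → vE (.rels f g) (PLTL.rels f g).delta) ∧
      (dep = true → (auxE (.rels f g) ↔ aux (.rels f g) k))
  | .prev f =>
      pincC dep k L s lsel inL LE v vE vL aux auxE f ∧
      (∀ d, d ≤ (PLTL.prev f).delta → ¬ v (.prev f) d 0) ∧
      (∀ i, 1 ≤ i → i ≤ k → (v (.prev f) 0 i ↔ pV v f 0 (i - 1))) ∧
      (∀ d, 1 ≤ d → d ≤ (PLTL.prev f).delta → ∀ i, 1 ≤ i → i ≤ k →
        (v (.prev f) d i ↔
          ((lsel i ∧ pW vE f (d - 1)) ∨ (¬ lsel i ∧ pV v f d (i - 1))))) ∧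
      incLastC dep k lsel LE v vE vL (.prev f)
  | .wprev f =>
      pincC dep k L s lsel inL LE v vE vL aux auxE f ∧
      (∀ d, d ≤ (PLTL.wprev f).delta → v (.wprev f) d 0) ∧
      (∀ i, 1 ≤ i → i ≤ k → (v (.wprev f) 0 i ↔ pV v f 0 (i - 1))) ∧
      (∀ d, 1 ≤ d → d ≤ (PLTL.wprev f).delta → ∀ i, 1 ≤ i → i ≤ k →
        (v (.wprev f) d i ↔
          ((lsel i ∧ pW vE f (d - 1)) ∨ (¬ lsel i ∧ pV v f d (i - 1))))) ∧
      incLastC dep k lsel LE v vE vL (.wprev f)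
  | .since f g =>
      pincC dep k L s lsel inL LE v vE vL aux auxE f ∧
      pincC dep k L s lsel inL LE v vE vL aux auxE g ∧
      (∀ d, d ≤ (PLTL.since f g).delta → (v (.since f g) d 0 ↔ pV v g d 0)) ∧
      (∀ i, 1 ≤ i → i ≤ k →
        (v (.since f g) 0 i ↔
          (pV v g 0 i ∨ (pV v f 0 i ∧ v (.since f g) 0 (i - 1))))) ∧
      (∀ d, 1 ≤ d → d ≤ (PLTL.since f g).delta → ∀ i, 1 ≤ i → i ≤ k →
        (v (.since f g) d i ↔
          (pV v g d i ∨ (pV v f d i ∧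
            ((lsel i ∧ vE (.since f g) (d - 1)) ∨
             (¬ lsel i ∧ v (.since f g) d (i - 1))))))) ∧
      incLastC dep k lsel LE v vE vL (.since f g)
  | .trig f g =>
      pincC dep k L s lsel inL LE v vE vL aux auxE f ∧
      pincC dep k L s lsel inL LE v vE vL aux auxE g ∧
      (∀ d, d ≤ (PLTL.trig f g).delta → (v (.trig f g) d 0 ↔ pV v g d 0)) ∧
      (∀ i, 1 ≤ i → i ≤ k →
        (v (.trig f g) 0 i ↔
          (pV v g 0 i ∧ (pV v f 0 i ∨ v (.trig f g) 0 (i - 1))))) ∧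
      (∀ d, 1 ≤ d → d ≤ (PLTL.trig f g).delta → ∀ i, 1 ≤ i → i ≤ k →
        (v (.trig f g) d i ↔
          (pV v g d i ∧ (pV v f d i ∨
            ((lsel i ∧ vE (.trig f g) (d - 1)) ∨
             (¬ lsel i ∧ v (.trig f g) d (i - 1))))))) ∧
      incLastC dep k lsel LE v vE vL (.trig f g)

/-- Satisfiability of the incremental PLTL eventuality encoding
`⟦M,ψ,k⟧ = ⟦M⟧_k ∧ ⟦LoopConstraints⟧_k ∧ ⟦LastStateFormula⟧_k ∧
⟦IncPLTL⟧_k ∧ ⟦ψ⟧^0_0` (the witness formula). -/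
def IncSat (M : Kripke S AP) (ψ : PLTL AP) (k : ℕ) : Prop :=
  ∃ (s : ℕ → S) (sE : S) (lsel inL : ℕ → Prop) (LE : Prop)
    (v : PLTL AP → ℕ → ℕ → Prop) (vE vL : PLTL AP → ℕ → Prop)
    (aux : PLTL AP → ℕ → Prop) (auxE : PLTL AP → Prop),
    ModelC M k s ∧ incLoopC true k s sE lsel inL LE ∧
    pincC true k M.L s lsel inL LE v vE vL aux auxE ψ ∧ v ψ 0 0

end BMC
namespace BMC

variable {AP S : Type}

/-- Negation of a PNF formula, via the standard dualities. -/
def PLTL.neg : PLTL AP → PLTL AP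
  | .atom p => .natom p
  | .natom p => .atom p
  | .conj f g => .disj f.neg g.neg
  | .disj f g => .conj f.neg g.neg
  | .next f => .next f.neg
  | .untl f g => .rels f.neg g.neg
  | .rels f g => .untl f.neg g.neg
  | .prev f => .wprev f.neg
  | .wprev f => .prev f.neg
  | .since f g => .trig f.neg g.neg
  | .trig f g => .since f.neg g.neg

/-- The list of subformulas of a PLTL formula. -/
def PLTL.subfs : PLTL AP → List (PLTL AP)
  | .atom p => [.atom p]
  | .natom p => [.natom p]
  | .conj f g => .conj f g :: (f.subfs ++ g.subfs)
  | .disj f g => .disj f g :: (f.subfs ++ g.subfs)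
  | .next f => .next f :: f.subfs
  | .untl f g => .untl f g :: (f.subfs ++ g.subfs)
  | .rels f g => .rels f g :: (f.subfs ++ g.subfs)
  | .prev f => .prev f :: f.subfs
  | .wprev f => .wprev f :: f.subfs
  | .since f g => .since f g :: (f.subfs ++ g.subfs)
  | .trig f g => .trig f g :: (f.subfs ++ g.subfs)

/-- `φ` is an until or release formula (so that it carries auxiliary
variables in the encoding). -/
def PLTL.isUR : PLTL AP → Prop
  | .untl _ _ => True
  | .rels _ _ => True
  | _ => False

/-- The simple path formula `⟦SimplePath⟧_k` for the incremental encoding of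
the formula `χ`: any two distinct positions `i < j ≤ k` differ in the system
state, in `InLoop`, in the formula variables at unrolling `0`, or (when both
are in the loop) in the full vectors of formula variables or of auxiliary
variables. -/
def SimplePathC (χ : PLTL AP) (k : ℕ) (s : ℕ → S) (inL : ℕ → Prop)
    (v : PLTL AP → ℕ → ℕ → Prop) (aux : PLTL AP → ℕ → Prop) : Prop :=
  ∀ i j, i < j → j ≤ k →
    (s i ≠ s j ∨
     ¬ (inL i ↔ inL j) ∨
     (∃ φ ∈ χ.subfs, ¬ (v φ 0 i ↔ v φ 0 j)) ∨
     (inL i ∧ inL j ∧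
       ((∃ φ ∈ χ.subfs, ∃ d, d ≤ PLTL.delta φ ∧ ¬ (v φ d i ↔ v φ d j)) ∨
        (∃ φ ∈ χ.subfs, φ.isUR ∧ ¬ (aux φ i ↔ aux φ j)))))

/-- Satisfiability of the witness formula `⟦M,χ,k⟧` conjoined with the simple
path formula `⟦SimplePath⟧_k`. -/
def WitSPSat (M : Kripke S AP) (χ : PLTL AP) (k : ℕ) : Prop :=
  ∃ (s : ℕ → S) (sE : S) (lsel inL : ℕ → Prop) (LE : Prop)
    (v : PLTL AP → ℕ → ℕ → Prop) (vE vL : PLTL AP → ℕ → Prop)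
    (aux : PLTL AP → ℕ → Prop) (auxE : PLTL AP → Prop),
    ModelC M k s ∧ incLoopC true k s sE lsel inL LE ∧
    pincC true k M.L s lsel inL LE v vE vL aux auxE χ ∧ v χ 0 0 ∧
    SimplePathC χ k s inL v aux

/-- Satisfiability of the completeness formula `⟦⟦M,χ,k⟧⟧` (the witness
formula with all `k`-dependent constraints removed) conjoined with the simple
path formula `⟦SimplePath⟧_k`. -/
def ComplSPSat (M : Kripke S AP) (χ : PLTL AP) (k : ℕ) : Prop :=
  ∃ (s : ℕ → S) (sE : S) (lsel inL : ℕ → Prop) (LE : Prop)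
    (v : PLTL AP → ℕ → ℕ → Prop) (vE vL : PLTL AP → ℕ → Prop)
    (aux : PLTL AP → ℕ → Prop) (auxE : PLTL AP → Prop),
    ModelC M k s ∧ incLoopC false k s sE lsel inL LE ∧
    pincC false k M.L s lsel inL LE v vE vL aux auxE χ ∧ v χ 0 0 ∧
    SimplePathC χ k s inL v aux

/-- `M ⊨ ψ`: every initialised infinite path of `M` satisfies `ψ`. -/
def Kripke.Models (M : Kripke S AP) (ψ : PLTL AP) : Prop :=
  ∀ π : ℕ → S, M.InitPath π → PLTL.sat M.L π ψ 0

end BMC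
namespace BMC

theorem sat_neg {S AP : Type} (L : S → Set AP) (π : ℕ → S) (φ : PLTL AP) :
    ∀ n, PLTL.sat L π φ.neg n ↔ ¬ PLTL.sat L π φ n := by
  induction φ with
  | atom p => intro n; simp [PLTL.neg, PLTL.sat]
  | natom p => intro n; simp [PLTL.neg, PLTL.sat]
  | conj f g hf hg => intro n; simp only [PLTL.neg, PLTL.sat, hf, hg]; tauto
  | disj f g hf hg => intro n; simp only [PLTL.neg, PLTL.sat, hf, hg]; tauto
  | next f hf => intro n; simp only [PLTL.neg, PLTL.sat, hf]
  | untl f g hf hg => intro n; simp only [PLTL.neg, PLTL.sat, hf, hg]; push Not; grind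
  | rels f g hf hg => intro n; simp only [PLTL.neg, PLTL.sat, hf, hg]; push Not; grind
  | prev f hf => intro n; simp only [PLTL.neg, PLTL.sat, hf]; grind
  | wprev f hf => intro n; simp only [PLTL.neg, PLTL.sat, hf]; grind
  | since f g hf hg => intro n; simp only [PLTL.neg, PLTL.sat, hf, hg]; push Not; grind
  | trig f g hf hg => intro n; simp only [PLTL.neg, PLTL.sat, hf, hg]; push Not; grind

theorem sat_untl {S AP : Type} (L : S → Set AP) (π : ℕ → S) (f g : PLTL AP) (n : ℕ) :
    PLTL.sat L π (.untl f g) n ↔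
      (PLTL.sat L π g n ∨ (PLTL.sat L π f n ∧ PLTL.sat L π (.untl f g) (n + 1))) := by
  simp only [PLTL.sat]
  constructor
  · rintro ⟨j, h1, h2, h3⟩
    rcases Nat.eq_or_lt_of_le h1 with h | h
    · left; rw [h]; exact h2
    · right; exact ⟨h3 n le_rfl h, j, h, h2, fun m hm => h3 m (by omega)⟩
  · rintro (h | ⟨h, j, h1, h2, h3⟩)
    · exact ⟨n, le_rfl, h, fun m _ _ => by omega⟩
    · refine ⟨j, by omega, h2, fun m hm hm' => ?_⟩
      rcases Nat.eq_or_lt_of_le hm with e | e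
      · rw [← e]; exact h
      · exact h3 m e hm'

theorem sat_rels {S AP : Type} (L : S → Set AP) (π : ℕ → S) (f g : PLTL AP) (n : ℕ) :
    PLTL.sat L π (.rels f g) n ↔
      (PLTL.sat L π g n ∧ (PLTL.sat L π f n ∨ PLTL.sat L π (.rels f g) (n + 1))) := by
  have h := sat_untl L π f.neg g.neg n
  have e : ∀ m, PLTL.sat L π (.untl f.neg g.neg) m ↔ ¬ PLTL.sat L π (.rels f g) m :=
    fun m => sat_neg L π (.rels f g) m
  rw [e, e, sat_neg, sat_neg] at h
  rw [← not_iff_not, h]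
  tauto

theorem sat_since {S AP : Type} (L : S → Set AP) (π : ℕ → S) (f g : PLTL AP) (n : ℕ) :
    PLTL.sat L π (.since f g) n ↔
      (PLTL.sat L π g n ∨ (PLTL.sat L π f n ∧ 0 < n ∧ PLTL.sat L π (.since f g) (n - 1))) := by
  simp only [PLTL.sat]
  constructor
  · rintro ⟨j, h1, h2, h3⟩
    rcases Nat.eq_or_lt_of_le h1 with h | h
    · left; rw [← h]; exact h2
    · right; exact ⟨h3 n h le_rfl, by omega, j, by omega, h2, fun m hm hm' => h3 m hm (by omega)⟩
  · rintro (h | ⟨h, h0, j, h1, h2, h3⟩)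
    · exact ⟨n, le_rfl, h, fun m _ _ => by omega⟩
    · refine ⟨j, by omega, h2, fun m hm hm' => ?_⟩
      rcases Nat.eq_or_lt_of_le hm' with e | e
      · rw [e]; exact h
      · exact h3 m hm (by omega)

theorem sat_trig {S AP : Type} (L : S → Set AP) (π : ℕ → S) (f g : PLTL AP) (n : ℕ) :
    PLTL.sat L π (.trig f g) n ↔
      (PLTL.sat L π g n ∧ (PLTL.sat L π f n ∨ n = 0 ∨ PLTL.sat L π (.trig f g) (n - 1))) := by
  have h := sat_since L π f.neg g.neg n
  have e : ∀ m, PLTL.sat L π (.since f.neg g.neg) m ↔ ¬ PLTL.sat L π (.trig f g) m :=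
    fun m => sat_neg L π (.trig f g) m
  rw [e, e, sat_neg, sat_neg] at h
  have : 0 < n ↔ ¬ n = 0 := by omega
  rw [← not_iff_not, h, this]
  tauto

/-- Local (tableau) conditions on a valuation of subformulas along a path. -/
def TabAt {S AP : Type} (L : S → Set AP) (π : ℕ → S) (val : PLTL AP → ℕ → Prop) : PLTL AP → Prop
  | .atom p => ∀ n, val (.atom p) n → p ∈ L (π n)
  | .natom p => ∀ n, val (.natom p) n → p ∉ L (π n)
  | .conj f g => ∀ n, val (.conj f g) n → val f n ∧ val g n
  | .disj f g => ∀ n, val (.disj f g) n → val f n ∨ val g n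
  | .next f => ∀ n, val (.next f) n → val f (n + 1)
  | .untl f g => (∀ n, val (.untl f g) n → val g n ∨ (val f n ∧ val (.untl f g) (n + 1))) ∧
      ∀ n, (∀ m, n ≤ m → val (.untl f g) m) → ∃ m, n ≤ m ∧ val g m
  | .rels f g => ∀ n, val (.rels f g) n → val g n ∧ (val f n ∨ val (.rels f g) (n + 1))
  | .prev f => ∀ n, val (.prev f) n → 0 < n ∧ val f (n - 1)
  | .wprev f => ∀ n, val (.wprev f) n → n = 0 ∨ val f (n - 1)
  | .since f g => ∀ n, val (.since f g) n →
      val g n ∨ (val f n ∧ 0 < n ∧ val (.since f g) (n - 1))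
  | .trig f g => ∀ n, val (.trig f g) n →
      val g n ∧ (val f n ∨ n = 0 ∨ val (.trig f g) (n - 1))

theorem subfs_self {AP : Type} (χ : PLTL AP) : χ ∈ χ.subfs := by
  cases χ <;> simp [PLTL.subfs]

theorem tab_sat {S AP : Type} (L : S → Set AP) (π : ℕ → S) (val : PLTL AP → ℕ → Prop)
    (χ : PLTL AP) : (∀ φ ∈ χ.subfs, TabAt L π val φ) → ∀ n, val χ n → PLTL.sat L π χ n := by
  induction χ with
  | atom p => intro h; exact h (.atom p) (subfs_self _)
  | natom p => intro h; exact h (.natom p) (subfs_self _)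
  | conj f g hf hg =>
    intro h n hv
    have h0 := h _ (subfs_self _)
    have hf := hf (fun φ hφ => h φ (by simp [PLTL.subfs, hφ]))
    have hg := hg (fun φ hφ => h φ (by simp [PLTL.subfs, hφ]))
    exact ⟨hf _ (h0 n hv).1, hg _ (h0 n hv).2⟩
  | disj f g hf hg =>
    intro h n hv
    have h0 := h _ (subfs_self _)
    have hf := hf (fun φ hφ => h φ (by simp [PLTL.subfs, hφ]))
    have hg := hg (fun φ hφ => h φ (by simp [PLTL.subfs, hφ]))
    exact (h0 n hv).imp (hf _) (hg _)
  | next f hf =>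
    intro h n hv
    have h0 := h _ (subfs_self _)
    have hf := hf (fun φ hφ => h φ (by simp [PLTL.subfs, hφ]))
    exact hf _ (h0 n hv)
  | untl f g hf hg =>
    intro h n hv
    have h0 := h (.untl f g) (by simp [PLTL.subfs])
    have hf := hf (fun φ hφ => h φ (by simp [PLTL.subfs, hφ]))
    have hg := hg (fun φ hφ => h φ (by simp [PLTL.subfs, hφ]))
    obtain ⟨h1, h2⟩ := h0
    by_contra hc
    have key : ∀ r, val (.untl f g) (n + r) ∧ ¬ PLTL.sat L π (.untl f g) (n + r) := by
      intro r
      induction r with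
      | zero => exact ⟨hv, hc⟩
      | succ r ih =>
        rw [sat_untl] at ih
        have a := hf (n + r)
        have b := hg (n + r)
        have c := h1 (n + r) ih.1
        rw [← add_assoc]
        tauto
    obtain ⟨m, hm, hgm⟩ := h2 n (fun m hm => by
      have := (key (m - n)).1; rwa [Nat.add_sub_cancel' hm] at this)
    have := (key (m - n)).2
    rw [Nat.add_sub_cancel' hm, sat_untl] at this
    exact this (Or.inl (hg _ hgm))
  | rels f g hf hg =>
    intro h n hv
    have h0 := h (.rels f g) (by simp [PLTL.subfs])
    have hf := hf (fun φ hφ => h φ (by simp [PLTL.subfs, hφ]))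
    have hg := hg (fun φ hφ => h φ (by simp [PLTL.subfs, hφ]))
    simp only [TabAt] at h0
    have key : ∀ r, val (.rels f g) (n + r) ∨ ∃ m, n ≤ m ∧ m < n + r ∧ PLTL.sat L π f m := by
      intro r
      induction r with
      | zero => exact Or.inl hv
      | succ r ih =>
        rcases ih with ih | ⟨m, a, b, c⟩
        · rcases (h0 _ ih).2 with h' | h'
          · exact Or.inr ⟨n + r, by omega, by omega, hf _ h'⟩
          · exact Or.inl h'
        · exact Or.inr ⟨m, a, by omega, c⟩
    intro j hj
    have := key (j - n)
    rw [Nat.add_sub_cancel' hj] at this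
    rcases this with h' | h'
    · exact Or.inl (hg _ (h0 _ h').1)
    · exact Or.inr h'
  | prev f hf =>
    intro h n hv
    have h0 := h (.prev f) (by simp [PLTL.subfs])
    have hf := hf (fun φ hφ => h φ (by simp [PLTL.subfs, hφ]))
    exact ⟨(h0 n hv).1, hf _ (h0 n hv).2⟩
  | wprev f hf =>
    intro h n hv
    have h0 := h (.wprev f) (by simp [PLTL.subfs])
    have hf := hf (fun φ hφ => h φ (by simp [PLTL.subfs, hφ]))
    exact (h0 n hv).imp id (hf _)
  | since f g hf hg =>
    intro h n
    have h0 := h (.since f g) (by simp [PLTL.subfs])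
    have hf := hf (fun φ hφ => h φ (by simp [PLTL.subfs, hφ]))
    have hg := hg (fun φ hφ => h φ (by simp [PLTL.subfs, hφ]))
    simp only [TabAt] at h0
    induction n with
    | zero => intro hv; rw [sat_since]; have := h0 _ hv; have := hg 0; simp at *; tauto
    | succ n ih =>
      intro hv; rw [sat_since]; have := h0 _ hv; have := hg (n+1); have := hf (n+1)
      simp only [Nat.add_sub_cancel] at *; tauto
  | trig f g hf hg =>
    intro h n
    have h0 := h (.trig f g) (by simp [PLTL.subfs])
    have hf := hf (fun φ hφ => h φ (by simp [PLTL.subfs, hφ]))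
    have hg := hg (fun φ hφ => h φ (by simp [PLTL.subfs, hφ]))
    simp only [TabAt] at h0
    induction n with
    | zero => intro hv; rw [sat_trig]; have := h0 _ hv; have := hg 0; simp at *; tauto
    | succ n ih =>
      intro hv; rw [sat_trig]; have := h0 _ hv; have := hg (n+1); have := hf (n+1)
      simp only [Nat.add_sub_cancel] at *; tauto

theorem subfs_trans {AP : Type} (χ : PLTL AP) :
    ∀ φ ∈ χ.subfs, ∀ θ ∈ φ.subfs, θ ∈ χ.subfs := by
  induction χ with
  | atom p => simp [PLTL.subfs]
  | natom p => simp [PLTL.subfs]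
  | conj f g hf hg | disj f g hf hg | untl f g hf hg | rels f g hf hg | since f g hf hg
  | trig f g hf hg =>
    intro φ hφ θ hθ
    simp only [PLTL.subfs, List.mem_cons, List.mem_append] at hφ
    rcases hφ with rfl | h | h
    · exact hθ
    · simp [PLTL.subfs, hf φ h θ hθ]
    · simp [PLTL.subfs, hg φ h θ hθ]
  | next f hf | prev f hf | wprev f hf =>
    intro φ hφ θ hθ
    simp only [PLTL.subfs, List.mem_cons] at hφ
    rcases hφ with rfl | h
    · exact hθ
    · simp [PLTL.subfs, hf φ h θ hθ]

/-- Index sequence generated by a jump function. -/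
def jseq (J : ℕ → ℕ) : ℕ → ℕ
  | 0 => 0
  | n + 1 => J (jseq J n) + 1

theorem jump_sat {S AP : Type} (M : Kripke S AP) (π : ℕ → S) (χ : PLTL AP) (J : ℕ → ℕ)
    (hπ : M.InitPath π) (hs : ∀ m, π (J m) = π m)
    (ht : ∀ φ ∈ χ.subfs, ∀ m, (PLTL.sat M.L π φ (J m) ↔ PLTL.sat M.L π φ m))
    (hev : ∀ f g, PLTL.untl f g ∈ χ.subfs → ∀ n,
      (∀ m, n ≤ m → PLTL.sat M.L π (.untl f g) (jseq J m)) →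
        ∃ m, n ≤ m ∧ PLTL.sat M.L π g (jseq J m))
    (h0 : PLTL.sat M.L π χ 0) :
    M.InitPath (π ∘ jseq J) ∧ PLTL.sat M.L (π ∘ jseq J) χ 0 := by
  refine ⟨⟨hπ.1, fun i => ?_⟩, ?_⟩
  · have := hπ.2 (J (jseq J i))
    rw [hs] at this
    exact this
  · apply tab_sat M.L (π ∘ jseq J) (fun φ n => PLTL.sat M.L π φ (jseq J n)) χ ?_ 0 h0
    intro φ hφ
    have hsub := subfs_trans χ φ hφ
    cases φ with
    | atom p => intro n hn; exact hn
    | natom p => intro n hn; exact hn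
    | conj f g => intro n hn; exact hn
    | disj f g => intro n hn; exact hn
    | next f =>
      intro n hn
      exact (ht _ hφ (jseq J n)).2 hn
    | untl f g =>
      refine ⟨fun n hn => ?_, hev f g hφ⟩
      have h1 := (sat_untl _ _ _ _ _).1 hn
      have h2 := (sat_untl _ _ _ _ _).1 ((ht _ hφ (jseq J n)).2 hn)
      have hg := ht g (hsub _ (by simp [PLTL.subfs, subfs_self])) (jseq J n)
      have hf := ht f (hsub _ (by simp [PLTL.subfs, subfs_self])) (jseq J n)
      simp only [jseq]
      tauto
    | rels f g =>
      intro n hn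
      have h1 := (sat_rels _ _ _ _ _).1 hn
      have h2 := (sat_rels _ _ _ _ _).1 ((ht _ hφ (jseq J n)).2 hn)
      have hg := ht g (hsub _ (by simp [PLTL.subfs, subfs_self])) (jseq J n)
      have hf := ht f (hsub _ (by simp [PLTL.subfs, subfs_self])) (jseq J n)
      simp only [jseq]
      tauto
    | prev f =>
      intro n hn
      cases n with
      | zero => simp [jseq, PLTL.sat] at hn
      | succ n =>
        have hf := ht f (hsub _ (by simp [PLTL.subfs, subfs_self])) (jseq J n)
        exact ⟨by omega, hf.1 hn.2⟩
    | wprev f =>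
      intro n hn
      cases n with
      | zero => exact Or.inl rfl
      | succ n =>
        have hf := ht f (hsub _ (by simp [PLTL.subfs, subfs_self])) (jseq J n)
        exact Or.inr (hf.1 (hn.resolve_left (by simp [jseq])))
    | since f g =>
      intro n hn
      have h1 := (sat_since _ _ _ _ _).1 hn
      cases n with
      | zero => simp only [jseq] at *; simp at h1; exact Or.inl h1
      | succ n =>
        have hf := ht _ hφ (jseq J n)
        simp only [jseq, Nat.add_sub_cancel] at *
        have : 0 < n + 1 := by omega
        tauto
    | trig f g =>
      intro n hn
      have h1 := (sat_trig _ _ _ _ _).1 hn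
      cases n with
      | zero => simp only [jseq] at *; simp at h1; exact ⟨h1, by simp⟩
      | succ n =>
        have hf := ht _ hφ (jseq J n)
        simp only [jseq, Nat.add_sub_cancel] at *
        have : ¬ (J (jseq J n) + 1 = 0) := by omega
        tauto

end BMC
namespace BMC

theorem since_per (P Q : ℕ → Prop) (N p : ℕ) (hp : 0 < p)
    (hP : ∀ n, N ≤ n → (P (n + p) ↔ P n)) (hQ : ∀ n, N ≤ n → (Q (n + p) ↔ Q n)) (n : ℕ)
    (hn : N + p ≤ n) :
    (∃ j, j ≤ n + p ∧ Q j ∧ ∀ m, j < m → m ≤ n + p → P m) ↔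
    (∃ j, j ≤ n ∧ Q j ∧ ∀ m, j < m → m ≤ n → P m) := by
  constructor
  · rintro ⟨j, h1, h2, h3⟩
    by_cases hj : j ≤ n
    · exact ⟨j, hj, h2, fun m a b => h3 m a (by omega)⟩
    · refine ⟨j - p, by omega, ?_, fun m a b => ?_⟩
      · rw [← hQ _ (by omega), Nat.sub_add_cancel (by omega)]; exact h2
      · rw [← hP _ (by omega)]; exact h3 _ (by omega) (by omega)
  · rintro ⟨j, h1, h2, h3⟩
    by_cases hj : N ≤ j
    · refine ⟨j + p, by omega, (hQ _ hj).2 h2, fun m a b => ?_⟩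
      have := hP (m - p) (by omega)
      rw [Nat.sub_add_cancel (by omega)] at this
      exact this.2 (h3 _ (by omega) (by omega))
    · refine ⟨j, by omega, h2, fun m a b => ?_⟩
      by_cases hm : m ≤ n
      · exact h3 m a hm
      · have := hP (m - p) (by omega)
        rw [Nat.sub_add_cancel (by omega)] at this
        exact this.2 (h3 _ (by omega) (by omega))

theorem untl_per (P Q : ℕ → Prop) (N p : ℕ)
    (hP : ∀ n, N ≤ n → (P (n + p) ↔ P n)) (hQ : ∀ n, N ≤ n → (Q (n + p) ↔ Q n)) (n : ℕ)
    (hn : N ≤ n) :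
    (∃ j, n + p ≤ j ∧ Q j ∧ ∀ m, n + p ≤ m → m < j → P m) ↔
    (∃ j, n ≤ j ∧ Q j ∧ ∀ m, n ≤ m → m < j → P m) := by
  constructor
  · rintro ⟨j, h1, h2, h3⟩
    refine ⟨j - p, by omega, ?_, fun m a b => ?_⟩
    · rw [← hQ _ (by omega), Nat.sub_add_cancel (by omega)]; exact h2
    · rw [← hP _ (by omega)]; exact h3 _ (by omega) (by omega)
  · rintro ⟨j, h1, h2, h3⟩
    refine ⟨j + p, by omega, (hQ _ (by omega)).2 h2, fun m a b => ?_⟩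
    have := hP (m - p) (by omega)
    rw [Nat.sub_add_cancel (by omega)] at this
    exact this.2 (h3 _ (by omega) (by omega))

theorem sat_per {S AP : Type} (L : S → Set AP) (π : ℕ → S) (l p : ℕ) (hp : 0 < p)
    (hper : ∀ i, l ≤ i → π (i + p) = π i) (φ : PLTL AP) :
    ∀ n, l + φ.delta * p ≤ n → (PLTL.sat L π φ (n + p) ↔ PLTL.sat L π φ n) := by
  have mx1 : ∀ a b n : ℕ, l + max a b * p ≤ n → l + a * p ≤ n := fun a b n h => by
    have := Nat.mul_le_mul_right p (le_max_left a b); omega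
  have mx2 : ∀ a b n : ℕ, l + max a b * p ≤ n → l + b * p ≤ n := fun a b n h => by
    have := Nat.mul_le_mul_right p (le_max_right a b); omega
  induction φ with
  | atom p => intro n hn; simp only [PLTL.sat, PLTL.delta] at *; rw [hper _ (by omega)]
  | natom p => intro n hn; simp only [PLTL.sat, PLTL.delta] at *; rw [hper _ (by omega)]
  | conj f g hf hg =>
    intro n hn; simp only [PLTL.sat, PLTL.delta] at *
    rw [hf _ (mx1 _ _ _ hn), hg _ (mx2 _ _ _ hn)]
  | disj f g hf hg =>
    intro n hn; simp only [PLTL.sat, PLTL.delta] at *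
    rw [hf _ (mx1 _ _ _ hn), hg _ (mx2 _ _ _ hn)]
  | next f hf =>
    intro n hn; simp only [PLTL.sat, PLTL.delta] at *
    rw [add_right_comm, hf _ (by omega)]
  | untl f g hf hg =>
    intro n hn
    exact untl_per _ _ (l + (max f.delta g.delta) * p) p
      (fun m hm => hf _ (mx1 _ _ _ hm)) (fun m hm => hg _ (mx2 _ _ _ hm)) n hn
  | rels f g hf hg =>
    intro n hn
    rw [← not_iff_not, ← sat_neg, ← sat_neg]
    refine untl_per _ _ (l + (max f.delta g.delta) * p) p
      (fun m hm => ?_) (fun m hm => ?_) n hn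
    · rw [sat_neg, sat_neg, hf _ (mx1 _ _ _ hm)]
    · rw [sat_neg, sat_neg, hg _ (mx2 _ _ _ hm)]
  | prev f hf =>
    intro n hn; simp only [PLTL.sat, PLTL.delta] at *
    rw [add_mul] at hn
    have := hf (n - 1) (by omega)
    rw [show n + p - 1 = n - 1 + p by omega, this]
    have h1 : 0 < n := by omega
    have h2 : 0 < n + p := by omega
    tauto
  | wprev f hf =>
    intro n hn; simp only [PLTL.sat, PLTL.delta] at *
    rw [add_mul] at hn
    have := hf (n - 1) (by omega)
    rw [show n + p - 1 = n - 1 + p by omega, this]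
    have h1 : ¬ n = 0 := by omega
    have h2 : ¬ n + p = 0 := by omega
    tauto
  | since f g hf hg =>
    intro n hn
    simp only [PLTL.delta, add_mul, one_mul] at hn
    exact since_per _ _ (l + (max f.delta g.delta) * p) p hp
      (fun m hm => hf _ (mx1 _ _ _ hm)) (fun m hm => hg _ (mx2 _ _ _ hm)) n (by omega)
  | trig f g hf hg =>
    intro n hn
    simp only [PLTL.delta, add_mul, one_mul] at hn
    rw [← not_iff_not, ← sat_neg, ← sat_neg]
    refine since_per _ _ (l + (max f.delta g.delta) * p) p hp
      (fun m hm => ?_) (fun m hm => ?_) n (by omega)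
    · rw [sat_neg, sat_neg, hf _ (mx1 _ _ _ hm)]
    · rw [sat_neg, sat_neg, hg _ (mx2 _ _ _ hm)]

theorem sat_per_mul {S AP : Type} (L : S → Set AP) (π : ℕ → S) (l p : ℕ) (hp : 0 < p)
    (hper : ∀ i, l ≤ i → π (i + p) = π i) (φ : PLTL AP) (q n : ℕ) (hn : l + φ.delta * p ≤ n) :
    (PLTL.sat L π φ (n + q * p) ↔ PLTL.sat L π φ n) := by
  induction q with
  | zero => simp
  | succ q ih =>
    rw [add_mul, one_mul, ← add_assoc, sat_per L π l p hp hper φ _ (by omega), ih]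

/-- Satisfaction only depends on the capped unrolling. -/
theorem sat_cap {S AP : Type} (L : S → Set AP) (π : ℕ → S) (l p : ℕ) (hp : 0 < p)
    (hper : ∀ i, l ≤ i → π (i + p) = π i) (φ : PLTL AP) (d d' i : ℕ) (hi : l ≤ i)
    (h : φ.delta ≤ d') (hd : d' ≤ d) :
    (PLTL.sat L π φ (i + d * p) ↔ PLTL.sat L π φ (i + d' * p)) := by
  obtain ⟨q, rfl⟩ := Nat.exists_eq_add_of_le hd
  rw [add_mul, ← add_assoc]
  apply sat_per_mul L π l p hp hper
  have := Nat.mul_le_mul_right p h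
  omega

/-- A lasso-shaped initialised path satisfying `χ`. -/
def Lasso {S AP : Type} (M : Kripke S AP) (χ : PLTL AP) (k l : ℕ) (π : ℕ → S) : Prop :=
  M.InitPath π ∧ IsKLoop π k l ∧ PLTL.sat M.L π χ 0

theorem lasso_exists {S AP : Type} [Finite S] (M : Kripke S AP) (χ : PLTL AP) (π : ℕ → S)
    (hπ : M.InitPath π) (h0 : PLTL.sat M.L π χ 0) : ∃ k l π', Lasso M χ k l π' := by
  classical
  have : Finite {φ // φ ∈ χ.subfs} := (List.finite_toSet χ.subfs).to_subtype
  let ty : ℕ → S × ({φ // φ ∈ χ.subfs} → Prop) :=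
    fun n => (π n, fun φ => PLTL.sat M.L π φ.1 n)
  obtain ⟨y, hy⟩ := Finite.exists_infinite_fiber ty
  have hinf : (ty ⁻¹' {y}).Infinite := Set.infinite_coe_iff.1 hy
  obtain ⟨a, ha⟩ := hinf.nonempty
  have hb : ∀ l : List (PLTL AP), ∃ B, ∀ f g, PLTL.untl f g ∈ l →
      PLTL.sat M.L π (.untl f g) (a + 1) → ∃ j, a < j ∧ j ≤ B ∧ PLTL.sat M.L π g j := by
    intro l
    induction l with
    | nil => exact ⟨0, by simp⟩
    | cons x l ih =>
      obtain ⟨B, hB⟩ := ih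
      by_cases hx : ∃ f g, x = PLTL.untl f g ∧ PLTL.sat M.L π (.untl f g) (a + 1)
      · obtain ⟨f, g, rfl, j, hj, hgj, -⟩ := hx
        refine ⟨max B j, fun f' g' hm hs => ?_⟩
        rcases List.mem_cons.1 hm with e | e
        · cases e
          exact ⟨j, hj, le_max_right _ _, hgj⟩
        · obtain ⟨j', h1, h2, h3⟩ := hB f' g' e hs
          exact ⟨j', h1, le_trans h2 (le_max_left _ _), h3⟩
      · refine ⟨B, fun f' g' hm hs => ?_⟩
        rcases List.mem_cons.1 hm with e | e
        · exact absurd ⟨f', g', e.symm, hs⟩ hx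
        · exact hB f' g' e hs
  obtain ⟨B, hB⟩ := hb χ.subfs
  obtain ⟨b, hbm, hbB⟩ := hinf.exists_gt (max B a)
  have hab : a < b := lt_of_le_of_lt (le_max_right _ _) hbB
  have hBb : B < b := lt_of_le_of_lt (le_max_left _ _) hbB
  have hty : ty a = ty b := by
    rw [Set.mem_preimage, Set.mem_singleton_iff] at ha hbm
    rw [ha, hbm]
  have hst : π a = π b := congrArg Prod.fst hty
  have hsat : ∀ φ ∈ χ.subfs, (PLTL.sat M.L π φ a ↔ PLTL.sat M.L π φ b) := fun φ hφ =>
    iff_of_eq (congrFun (congrArg Prod.snd hty) ⟨φ, hφ⟩)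
  let J : ℕ → ℕ := fun m => if m = b then a else m
  have j1 : ∀ n, n ≤ b → jseq J n = n := by
    intro n
    induction n with
    | zero => intro _; rfl
    | succ n ih => intro hn; simp only [jseq, ih (by omega), J]; rw [if_neg (by omega)]
  have j2 : ∀ n, jseq J (a + 1 + n + (b - a)) = jseq J (a + 1 + n) := by
    intro n
    induction n with
    | zero =>
      rw [show a + 1 + 0 + (b - a) = b + 1 by omega, jseq, j1 b le_rfl, j1 _ (by omega)]
      simp [J]
    | succ n ih =>
      rw [show a + 1 + (n + 1) + (b - a) = a + 1 + n + (b - a) + 1 by omega, jseq, ih]; rfl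
  have j3 : ∀ q j, a < j → j ≤ b → jseq J (j + q * (b - a)) = j := by
    intro q j h1 h2
    induction q with
    | zero => rw [zero_mul]; exact j1 j h2
    | succ q ih =>
      have := j2 (j - a - 1 + q * (b - a))
      rw [add_mul, one_mul]
      rw [show j + (q * (b - a) + (b - a)) = a + 1 + (j - a - 1 + q * (b - a)) + (b - a) by omega,
        this, show a + 1 + (j - a - 1 + q * (b - a)) = j + q * (b - a) by omega, ih]
  have hbig : ∀ n, n ≤ n * (b - a) := fun n => Nat.le_mul_of_pos_right n (by omega)
  have hJ := jump_sat M π χ J hπ (fun m => by simp only [J]; split_ifs with h; rw [h, hst]; rfl)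
    (fun φ hφ m => by
      simp only [J]; split_ifs with h
      · rw [h]; exact hsat φ hφ
      · rfl)
    (fun f g hfg n hall => by
      have h1 := hall (a + 1 + n * (b - a)) (by have := hbig n; omega)
      rw [j3 n (a + 1) (by omega) (by omega)] at h1
      obtain ⟨j, h2, h3, h4⟩ := hB f g hfg h1
      refine ⟨j + n * (b - a), by have := hbig n; omega, ?_⟩
      rw [j3 n j h2 (by omega)]; exact h4) h0
  refine ⟨b, a + 1, π ∘ jseq J, hJ.1, ⟨by omega, by omega, ?_, ?_⟩, hJ.2⟩
  · simp only [Function.comp, Nat.add_sub_cancel]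
    rw [j1 a (by omega), j1 b le_rfl, hst]
  · intro i hi
    simp only [Function.comp]
    have := j2 (i - a - 1)
    rw [show a + 1 + (i - a - 1) = i by omega] at this
    rw [show b + 1 - (a + 1) = b - a by omega, this]

theorem stem_cut {S AP : Type} (M : Kripke S AP) (χ : PLTL AP) (π : ℕ → S) (k l i j : ℕ)
    (h : Lasso M χ k l π) (hij : i < j) (hjl : j < l) (hst : π i = π j)
    (hsat : ∀ φ ∈ χ.subfs, (PLTL.sat M.L π φ i ↔ PLTL.sat M.L π φ j)) :
    ∃ k', k' < k ∧ ∃ l' π', Lasso M χ k' l' π' := by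
  obtain ⟨hπ, ⟨hl0, hlk, hlp, hper⟩, h0⟩ := h
  let J : ℕ → ℕ := fun m => if m = i then j else m
  have j1 : ∀ n, n ≤ i → jseq J n = n := by
    intro n
    induction n with
    | zero => intro _; rfl
    | succ n ih => intro hn; simp only [jseq, ih (by omega), J]; rw [if_neg (by omega)]
  have j2 : ∀ n, jseq J (i + 1 + n) = j + 1 + n := by
    intro n
    induction n with
    | zero => rw [add_zero, jseq, j1 i le_rfl]; simp [J]
    | succ n ih => rw [← add_assoc, jseq, ih]; simp only [J]; rw [if_neg (by omega)]; rfl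
  have j3 : ∀ n, i < n → jseq J n = n + (j - i) := by
    intro n hn
    have := j2 (n - i - 1)
    rw [show i + 1 + (n - i - 1) = n by omega] at this
    omega
  have hJ := jump_sat M π χ J hπ (fun m => by simp only [J]; split_ifs with h; rw [h, hst]; rfl)
    (fun φ hφ m => by
      simp only [J]; split_ifs with h
      · rw [h]; exact (hsat φ hφ).symm
      · rfl)
    (fun f g hfg n hall => by
      obtain ⟨m, h1, h2, -⟩ := hall (n + i + 1) (by omega)
      rw [j3 _ (by omega)] at h1
      refine ⟨m - (j - i), by omega, ?_⟩
      rw [j3 _ (by omega), Nat.sub_add_cancel (by omega)]; exact h2) h0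
  refine ⟨k - (j - i), by omega, l - (j - i), π ∘ jseq J, hJ.1,
    ⟨by omega, by omega, ?_, ?_⟩, hJ.2⟩
  · simp only [Function.comp]
    rw [j3 (k - (j - i)) (by omega), Nat.sub_add_cancel (by omega), ← hlp]
    by_cases hh : j = l - 1
    · rw [j1 _ (by omega), show l - (j - i) - 1 = i by omega, hst, hh]
    · rw [j3 _ (by omega)]; congr 1; omega
  · intro m hm
    simp only [Function.comp]
    rw [j3 _ (by omega), j3 _ (by omega)]
    have := hper (m + (j - i)) (by omega)
    rw [← this]
    congr 1; omega

theorem loop_cut {S AP : Type} (M : Kripke S AP) (χ : PLTL AP) (π : ℕ → S) (k l i j : ℕ)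
    (h : Lasso M χ k l π) (hli : l ≤ i) (hij : i < j) (hjl : j ≤ k) (hst : π i = π j)
    (hsat : ∀ φ ∈ χ.subfs, ∀ d, d ≤ φ.delta → (PLTL.sat M.L π φ (i + d * (k + 1 - l)) ↔
      PLTL.sat M.L π φ (j + d * (k + 1 - l))))
    (haux : ∀ f g, PLTL.untl f g ∈ χ.subfs →
      (∃ m, l ≤ m ∧ m ≤ j ∧ PLTL.sat M.L π g (m + g.delta * (k + 1 - l))) →
      (∃ m, l ≤ m ∧ m ≤ i ∧ PLTL.sat M.L π g (m + g.delta * (k + 1 - l)))) :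
    ∃ k', k' < k ∧ ∃ l' π', Lasso M χ k' l' π' := by
  obtain ⟨hπ, ⟨hl0, hlk, hlp, hper⟩, h0⟩ := h
  obtain ⟨p, hp⟩ : ∃ p, p = k + 1 - l := ⟨_, rfl⟩
  rw [← hp] at hper hsat haux
  have hp0 : 0 < p := by omega
  have hmper : ∀ q m, l ≤ m → π (m + q * p) = π m := by
    intro q m hm
    induction q with
    | zero => simp
    | succ q ih => rw [add_mul, one_mul, ← add_assoc, hper _ (by omega), ih]
  have hsat' : ∀ φ ∈ χ.subfs, ∀ d, (PLTL.sat M.L π φ (i + d * p) ↔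
      PLTL.sat M.L π φ (j + d * p)) := by
    intro φ hφ d
    by_cases hd : d ≤ φ.delta
    · exact hsat φ hφ d hd
    · rw [sat_cap M.L π l p hp0 hper φ d φ.delta i hli le_rfl (by omega),
        sat_cap M.L π l p hp0 hper φ d φ.delta j (by omega) le_rfl (by omega)]
      exact hsat φ hφ _ le_rfl
  classical
  let J : ℕ → ℕ := fun m => if (l ≤ m ∧ (m - l) % p = i - l) then m + (j - i) else m
  have hJi : ∀ m, (l ≤ m ∧ (m - l) % p = i - l) → ∃ q, m = i + q * p := by
    rintro m ⟨h1, h2⟩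
    refine ⟨(m - l) / p, ?_⟩
    have := Nat.div_add_mod (m - l) p
    rw [mul_comm] at this
    omega
  have hsm : ∀ m, m ≤ k → l ≤ m → (m - l) % p = m - l := fun m _ _ =>
    Nat.mod_eq_of_lt (by omega)
  have j1 : ∀ n, n ≤ i → jseq J n = n := by
    intro n
    induction n with
    | zero => intro _; rfl
    | succ n ih =>
      intro hn; simp only [jseq, ih (by omega), J]; rw [if_neg]
      rintro ⟨h1, h2⟩
      rw [hsm _ (by omega) h1] at h2; omega
  have j2 : ∀ n, j + n ≤ k → jseq J (i + 1 + n) = j + 1 + n := by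
    intro n
    induction n with
    | zero =>
      intro _
      rw [add_zero, jseq, j1 i le_rfl]; simp only [J]
      rw [if_pos ⟨hli, hsm _ (by omega) hli⟩]; omega
    | succ n ih =>
      intro hn
      rw [← add_assoc, jseq, ih (by omega)]; simp only [J]; rw [if_neg]; rfl
      rintro ⟨h1, h2⟩
      rw [hsm _ (by omega) h1] at h2; omega
  have j3 : ∀ n, i < n → n + (j - i) ≤ k + 1 → jseq J n = n + (j - i) := by
    intro n hn hk
    have := j2 (n - i - 1) (by omega)
    rw [show i + 1 + (n - i - 1) = n by omega] at this
    omega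
  obtain ⟨p', hp'⟩ : ∃ p', p' = p - (j - i) := ⟨_, rfl⟩
  have hJp : ∀ m, l ≤ m → J (m + p) = J m + p := by
    intro m hm
    simp only [J]
    have e : (m + p - l) % p = (m - l) % p := by
      rw [show m + p - l = m - l + p by omega, Nat.add_mod_right]
    have e2 : l ≤ m + p := by omega
    simp only [e, hm, e2, true_and]
    split_ifs <;> omega
  have hge : ∀ n, l ≤ jseq J (l + n) := by
    intro n
    induction n with
    | zero => rw [add_zero, j1 l hli]
    | succ n ih =>
      have hle : ∀ m, m ≤ J m := fun m => by simp only [J]; split_ifs <;> omega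
      have := hle (jseq J (l + n))
      rw [← add_assoc, jseq]; omega
  have j4 : ∀ n, jseq J (l + n + p') = jseq J (l + n) + p := by
    intro n
    induction n with
    | zero => rw [add_zero, j3 _ (by omega) (by omega), j1 l hli]; omega
    | succ n ih =>
      rw [show l + (n + 1) + p' = l + n + p' + 1 by omega, jseq, ih, hJp _ (hge n),
        ← add_assoc, jseq]; omega
  have j5 : ∀ q n, l ≤ n → jseq J (n + q * p') = jseq J n + q * p := by
    intro q n hn
    induction q with
    | zero => simp
    | succ q ih =>
      have := j4 (n - l + q * p')
      rw [show l + (n - l + q * p') = n + q * p' by omega, ih] at this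
      rw [add_mul, add_mul, one_mul, one_mul, ← add_assoc, this]; omega
  have hbig : ∀ n, n ≤ n * p' := fun n => Nat.le_mul_of_pos_right n (by omega)
  have hJ := jump_sat M π χ J hπ
    (fun m => by
      simp only [J]; split_ifs with h
      · obtain ⟨q, rfl⟩ := hJi m h
        rw [show i + q * p + (j - i) = j + q * p by omega, hmper _ _ hli, hmper _ _ (by omega), hst]
      · rfl)
    (fun φ hφ m => by
      simp only [J]; split_ifs with h
      · obtain ⟨q, rfl⟩ := hJi m h
        rw [show i + q * p + (j - i) = j + q * p by omega]
        exact (hsat' φ hφ q).symm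
      · rfl)
    (fun f g hfg n hall => by
      obtain ⟨Q, hQ⟩ : ∃ Q, Q = n + g.delta := ⟨_, rfl⟩
      have hn := hbig Q
      have key : ∀ t, l ≤ t → (t ≤ i ∨ (j < t ∧ t ≤ k)) →
          PLTL.sat M.L π g (t + g.delta * p) → ∃ m, n ≤ m ∧ PLTL.sat M.L π g (jseq J m) := by
        intro t ht1 ht2 ht3
        rw [← sat_cap M.L π l p hp0 hper g Q g.delta t ht1 le_rfl (by omega)] at ht3
        rcases ht2 with ht2 | ⟨ht2, ht4⟩
        · refine ⟨t + Q * p', by omega, ?_⟩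
          rw [j5 _ _ ht1, j1 _ ht2]; exact ht3
        · refine ⟨t - (j - i) + Q * p', by omega, ?_⟩
          rw [j5 _ _ (by omega), j3 _ (by omega) (by omega), Nat.sub_add_cancel (by omega)]
          exact ht3
      obtain ⟨m, h1, h2, -⟩ := hall (l + Q * p') (by omega)
      rw [j5 _ _ le_rfl, j1 l hli] at h1
      have hdm := Nat.div_add_mod (m - l) p
      have hlt := Nat.mod_lt (m - l) hp0
      have hQle : Q ≤ (m - l) / p := (Nat.le_div_iff_mul_le hp0).2 (by omega)
      obtain ⟨t, ht⟩ : ∃ t, t = l + (m - l) % p := ⟨_, rfl⟩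
      rw [mul_comm] at hdm
      rw [show m = t + (m - l) / p * p by omega,
        sat_cap M.L π l p hp0 hper g _ g.delta t (by omega) le_rfl (by omega)] at h2
      by_cases hc : t ≤ i ∨ (j < t ∧ t ≤ k)
      · exact key t (by omega) hc h2
      · obtain ⟨t', a, b, c⟩ := haux f g hfg ⟨t, by omega, by omega, h2⟩
        exact key t' a (Or.inl b) c) h0
  refine ⟨k - (j - i), by omega, l, π ∘ jseq J, hJ.1,
    ⟨by omega, by omega, ?_, ?_⟩, hJ.2⟩
  · simp only [Function.comp]
    rw [j1 _ (by omega), hlp]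
    by_cases hh : j = k
    · rw [j1 _ (by omega), show k - (j - i) = i by omega, hst, hh]
    · rw [j3 _ (by omega) (by omega)]; congr 1; omega
  · intro m hm
    simp only [Function.comp]
    have := j4 (m - l)
    rw [show l + (m - l) = m by omega] at this
    rw [show k - (j - i) + 1 - l = p' by omega, this]
    apply hper
    have := hge (m - l)
    rwa [show l + (m - l) = m by omega] at this

end BMC
namespace BMC

/-- Backward recursion for until-like operators before the loop. -/
def UU (P Q : ℕ → Prop) (b : Prop) (l : ℕ) : ℕ → Prop
  | 0 => b
  | r + 1 => Q (l - (r + 1)) ∨ (P (l - (r + 1)) ∧ UU P Q b l r)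

def SS (P Q : ℕ → Prop) : ℕ → Prop
  | 0 => Q 0
  | n + 1 => Q (n + 1) ∨ (P (n + 1) ∧ SS P Q n)

def TT (P Q : ℕ → Prop) : ℕ → Prop
  | 0 => Q 0
  | n + 1 => Q (n + 1) ∧ (P (n + 1) ∨ TT P Q n)

/-- Formula values at indices before the loop. -/
def BB {S AP : Type} (L : S → Set AP) (π : ℕ → S) (l : ℕ) (base : PLTL AP → Prop) :
    PLTL AP → ℕ → Prop
  | .atom p => fun i => p ∈ L (π i)
  | .natom p => fun i => p ∉ L (π i)
  | .conj f g => fun i => BB L π l base f i ∧ BB L π l base g i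
  | .disj f g => fun i => BB L π l base f i ∨ BB L π l base g i
  | .next f => fun i => (i + 1 < l ∧ BB L π l base f (i + 1)) ∨ (l ≤ i + 1 ∧ base f)
  | .untl f g => fun i => UU (BB L π l base f) (BB L π l base g) (base (.untl f g)) l (l - i)
  | .rels f g => fun i => UU (BB L π l base g)
      (fun n => BB L π l base g n ∧ BB L π l base f n) (base (.rels f g)) l (l - i)
  | .prev f => fun i => 0 < i ∧ BB L π l base f (i - 1)
  | .wprev f => fun i => i = 0 ∨ BB L π l base f (i - 1)
  | .since f g => SS (BB L π l base f) (BB L π l base g)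
  | .trig f g => TT (BB L π l base f) (BB L π l base g)

def VV {S AP : Type} (L : S → Set AP) (π : ℕ → S) (l p : ℕ) (φ : PLTL AP) (d i : ℕ) : Prop :=
  if l ≤ i then PLTL.sat L π φ (i + d * p)
  else BB L π l (fun θ => PLTL.sat L π θ (l + d * p)) φ i

theorem VV_ge {S AP : Type} {L : S → Set AP} {π : ℕ → S} {l p : ℕ} {φ : PLTL AP} {d i : ℕ}
    (h : l ≤ i) : VV L π l p φ d i ↔ PLTL.sat L π φ (i + d * p) := by
  simp [VV, h]

theorem VV_lt {S AP : Type} {L : S → Set AP} {π : ℕ → S} {l p : ℕ} {φ : PLTL AP} {d i : ℕ}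
    (h : i < l) : VV L π l p φ d i ↔ BB L π l (fun θ => PLTL.sat L π θ (l + d * p)) φ i := by
  simp [VV, not_le.2 h]

theorem BB_sat {S AP : Type} (L : S → Set AP) (π : ℕ → S) (l : ℕ) (φ : PLTL AP) :
    ∀ i, i < l → (BB L π l (fun θ => PLTL.sat L π θ l) φ i ↔ PLTL.sat L π φ i) := by
  induction φ with
  | atom p => intro i hi; rfl
  | natom p => intro i hi; rfl
  | conj f g hf hg => intro i hi; simp only [BB, PLTL.sat, hf i hi, hg i hi]
  | disj f g hf hg => intro i hi; simp only [BB, PLTL.sat, hf i hi, hg i hi]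
  | next f hf =>
    intro i hi
    simp only [BB, PLTL.sat]
    by_cases h : i + 1 < l
    · simp [h, hf _ h]
    · have : l = i + 1 := by omega
      simp [this]
  | untl f g hf hg =>
    have key : ∀ r, r ≤ l → (UU (BB L π l (fun θ => PLTL.sat L π θ l) f)
        (BB L π l (fun θ => PLTL.sat L π θ l) g) (PLTL.sat L π (.untl f g) l) l r ↔
        PLTL.sat L π (.untl f g) (l - r)) := by
      intro r
      induction r with
      | zero => intro _; rfl
      | succ r ih =>
        intro hr
        rw [UU, ih (by omega), sat_untl L π f g (l - (r + 1)), hf _ (by omega), hg _ (by omega),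
          show l - (r + 1) + 1 = l - r by omega]
    intro i hi
    have := key (l - i) (by omega)
    rw [show l - (l - i) = i by omega] at this
    exact this
  | rels f g hf hg =>
    have key : ∀ r, r ≤ l → (UU (BB L π l (fun θ => PLTL.sat L π θ l) g)
        (fun n => BB L π l (fun θ => PLTL.sat L π θ l) g n ∧
          BB L π l (fun θ => PLTL.sat L π θ l) f n) (PLTL.sat L π (.rels f g) l) l r ↔
        PLTL.sat L π (.rels f g) (l - r)) := by
      intro r
      induction r with
      | zero => intro _; rfl
      | succ r ih =>
        intro hr
        rw [UU, ih (by omega), sat_rels L π f g (l - (r + 1)), hf _ (by omega), hg _ (by omega),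
          show l - (r + 1) + 1 = l - r by omega]
        tauto
    intro i hi
    have := key (l - i) (by omega)
    rw [show l - (l - i) = i by omega] at this
    exact this
  | prev f hf => intro i hi; simp only [BB, PLTL.sat, hf (i - 1) (by omega)]
  | wprev f hf => intro i hi; simp only [BB, PLTL.sat, hf (i - 1) (by omega)]
  | since f g hf hg =>
    intro i
    induction i with
    | zero => intro hi; rw [sat_since]; simp [BB, SS, hg 0 hi]
    | succ i ih =>
      intro hi
      have ih := ih (by omega)
      rw [sat_since]; simp only [BB, SS] at *
      rw [ih, hf _ hi, hg _ hi]; simp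
  | trig f g hf hg =>
    intro i
    induction i with
    | zero => intro hi; rw [sat_trig]; simp [BB, TT, hg 0 hi]
    | succ i ih =>
      intro hi
      have ih := ih (by omega)
      rw [sat_trig]; simp only [BB, TT] at *
      rw [ih, hf _ hi, hg _ hi]; simp

theorem VV_zero {S AP : Type} (L : S → Set AP) (π : ℕ → S) (l p : ℕ) (φ : PLTL AP) (i : ℕ) :
    VV L π l p φ 0 i ↔ PLTL.sat L π φ i := by
  by_cases h : l ≤ i
  · rw [VV_ge h]; simp
  · rw [VV_lt (by omega)]
    simp only [zero_mul, add_zero]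
    exact BB_sat L π l φ i (by omega)

theorem BB_cap {S AP : Type} (L : S → Set AP) (π : ℕ → S) (l p : ℕ) (hp : 0 < p)
    (hper : ∀ i, l ≤ i → π (i + p) = π i) (φ : PLTL AP) (d d' : ℕ)
    (hd : d' ≤ d) : φ.delta ≤ d' →
    BB L π l (fun θ => PLTL.sat L π θ (l + d * p)) φ =
    BB L π l (fun θ => PLTL.sat L π θ (l + d' * p)) φ := by
  have cap := fun (θ : PLTL AP) (h : θ.delta ≤ d') =>
    propext (sat_cap L π l p hp hper θ d d' l le_rfl h hd)
  induction φ with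
  | atom p => intro _; rfl
  | natom p => intro _; rfl
  | conj f g hf hg | disj f g hf hg | since f g hf hg | trig f g hf hg =>
    intro h
    simp only [PLTL.delta] at h
    simp only [BB, hf (by omega), hg (by omega)]
  | next f hf =>
    intro h
    simp only [PLTL.delta] at h
    simp only [BB, hf (by omega), cap f (by omega)]
  | prev f hf | wprev f hf =>
    intro h
    simp only [PLTL.delta] at h
    simp only [BB, hf (by omega)]
  | untl f g hf hg | rels f g hf hg =>
    intro h
    have := cap _ h
    simp only [PLTL.delta] at h
    simp only [BB, hf (by omega), hg (by omega), this]

theorem VV_cap {S AP : Type} (L : S → Set AP) (π : ℕ → S) (l p : ℕ) (hp : 0 < p)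
    (hper : ∀ i, l ≤ i → π (i + p) = π i) (φ : PLTL AP) (d i : ℕ) :
    VV L π l p φ (min d φ.delta) i ↔ VV L π l p φ d i := by
  by_cases hd : d ≤ φ.delta
  · rw [min_eq_left hd]
  · rw [min_eq_right (by omega)]
    by_cases h : l ≤ i
    · rw [VV_ge h, VV_ge h]
      exact (sat_cap L π l p hp hper φ d φ.delta i h le_rfl (by omega)).symm
    · rw [VV_lt (by omega), VV_lt (by omega),
        BB_cap L π l p hp hper φ d φ.delta (by omega) le_rfl]

section
variable {S AP : Type} (L : S → Set AP) (π : ℕ → S) (l p : ℕ)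

theorem VV_conj (f g : PLTL AP) (d i : ℕ) :
    VV L π l p (.conj f g) d i ↔ (VV L π l p f d i ∧ VV L π l p g d i) := by
  by_cases h : l ≤ i
  · simp only [VV_ge h, PLTL.sat]
  · simp only [VV_lt (not_le.1 h), BB]

theorem VV_disj (f g : PLTL AP) (d i : ℕ) :
    VV L π l p (.disj f g) d i ↔ (VV L π l p f d i ∨ VV L π l p g d i) := by
  by_cases h : l ≤ i
  · simp only [VV_ge h, PLTL.sat]
  · simp only [VV_lt (not_le.1 h), BB]

theorem VV_next (f : PLTL AP) (d i : ℕ) :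
    VV L π l p (.next f) d i ↔ VV L π l p f d (i + 1) := by
  by_cases h : l ≤ i
  · rw [VV_ge h, VV_ge (by omega), PLTL.sat, add_right_comm]
  · rw [VV_lt (not_le.1 h)]
    by_cases h' : i + 1 < l
    · rw [VV_lt h']; simp [BB, h']
    · have e : i + 1 = l := by omega
      rw [VV_ge (by omega)]; simp [BB, e]

theorem VV_untl (f g : PLTL AP) (d i : ℕ) :
    VV L π l p (.untl f g) d i ↔
      (VV L π l p g d i ∨ (VV L π l p f d i ∧ VV L π l p (.untl f g) d (i + 1))) := by
  by_cases h : l ≤ i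
  · rw [VV_ge h, VV_ge h, VV_ge h, VV_ge (by omega), sat_untl, add_right_comm]
  · rw [VV_lt (not_le.1 h), VV_lt (not_le.1 h), VV_lt (not_le.1 h)]
    have e : l - i = (l - i - 1) + 1 := by omega
    simp only [BB]
    rw [e, UU, ← e, show l - (l - i) = i by omega]
    by_cases h' : i + 1 < l
    · rw [VV_lt h']; simp only [BB]; rw [show l - (i + 1) = l - i - 1 by omega]
    · have e : i + 1 = l := by omega
      rw [VV_ge (by omega), show l - i - 1 = 0 by omega, e]; simp [UU]

theorem VV_rels (f g : PLTL AP) (d i : ℕ) :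
    VV L π l p (.rels f g) d i ↔
      (VV L π l p g d i ∧ (VV L π l p f d i ∨ VV L π l p (.rels f g) d (i + 1))) := by
  by_cases h : l ≤ i
  · rw [VV_ge h, VV_ge h, VV_ge h, VV_ge (by omega), sat_rels, add_right_comm]
  · rw [VV_lt (not_le.1 h), VV_lt (not_le.1 h), VV_lt (not_le.1 h)]
    have e : l - i = (l - i - 1) + 1 := by omega
    simp only [BB]
    rw [e, UU, ← e, show l - (l - i) = i by omega]
    by_cases h' : i + 1 < l
    · rw [VV_lt h']; simp only [BB]; rw [show l - (i + 1) = l - i - 1 by omega]; tauto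
    · have e : i + 1 = l := by omega
      rw [VV_ge (by omega), show l - i - 1 = 0 by omega, e]; simp only [UU]; tauto

theorem VV_prev (f : PLTL AP) (d i : ℕ) (h0 : 0 < i) (hi : i ≠ l) :
    VV L π l p (.prev f) d i ↔ VV L π l p f d (i - 1) := by
  by_cases h : l ≤ i
  · rw [VV_ge h, VV_ge (by omega), PLTL.sat, show i + d * p - 1 = i - 1 + d * p by omega]
    simp; omega
  · rw [VV_lt (not_le.1 h), VV_lt (by omega)]; simp [BB, h0]

theorem VV_wprev (f : PLTL AP) (d i : ℕ) (h0 : 0 < i) (hi : i ≠ l) :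
    VV L π l p (.wprev f) d i ↔ VV L π l p f d (i - 1) := by
  by_cases h : l ≤ i
  · rw [VV_ge h, VV_ge (by omega), PLTL.sat, show i + d * p - 1 = i - 1 + d * p by omega]
    simp; omega
  · rw [VV_lt (not_le.1 h), VV_lt (by omega)]; simp [BB]; omega

theorem VV_since (f g : PLTL AP) (d i : ℕ) (h0 : 0 < i) (hi : i ≠ l) :
    VV L π l p (.since f g) d i ↔
      (VV L π l p g d i ∨ (VV L π l p f d i ∧ VV L π l p (.since f g) d (i - 1))) := by
  by_cases h : l ≤ i
  · rw [VV_ge h, VV_ge h, VV_ge h, VV_ge (by omega), sat_since,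
      show i + d * p - 1 = i - 1 + d * p by omega]
    have : 0 < i + d * p := by omega
    simp [this]
  · rw [VV_lt (not_le.1 h), VV_lt (not_le.1 h), VV_lt (not_le.1 h), VV_lt (by omega)]
    obtain ⟨i, rfl⟩ : ∃ i', i = i' + 1 := ⟨i - 1, by omega⟩
    simp only [BB, SS, Nat.add_sub_cancel]

theorem VV_trig (f g : PLTL AP) (d i : ℕ) (h0 : 0 < i) (hi : i ≠ l) :
    VV L π l p (.trig f g) d i ↔
      (VV L π l p g d i ∧ (VV L π l p f d i ∨ VV L π l p (.trig f g) d (i - 1))) := by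
  by_cases h : l ≤ i
  · rw [VV_ge h, VV_ge h, VV_ge h, VV_ge (by omega), sat_trig,
      show i + d * p - 1 = i - 1 + d * p by omega]
    have : ¬ (i + d * p = 0) := by omega
    simp only [this, false_or]
  · rw [VV_lt (not_le.1 h), VV_lt (not_le.1 h), VV_lt (not_le.1 h), VV_lt (by omega)]
    obtain ⟨i, rfl⟩ : ∃ i', i = i' + 1 := ⟨i - 1, by omega⟩
    simp only [BB, TT, Nat.add_sub_cancel]

end

/-- Canonical auxiliary variables. -/
def AX {S AP : Type} (L : S → Set AP) (π : ℕ → S) (l p : ℕ) : PLTL AP → ℕ → Prop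
  | .untl _ g => fun i => ∃ m, l ≤ m ∧ m ≤ i ∧ PLTL.sat L π g (m + g.delta * p)
  | .rels _ g => fun i => ∀ m, l ≤ m → m ≤ i → PLTL.sat L π g (m + g.delta * p)
  | _ => fun _ => False

theorem canon_last {S AP : Type} (L : S → Set AP) (π : ℕ → S) (k l p K : ℕ) (dep : Bool)
    (hp : p + l = k + 1) (hlk : l ≤ k)
    (hper : ∀ i, l ≤ i → π (i + p) = π i) (hdep : dep = true → K = k)
    (φ : PLTL AP) :
    incLastC dep K (fun i => i = l) True (VV L π l p)
      (fun θ d => VV L π l p θ d k) (fun θ d => VV L π l p θ d l) φ := by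
  intro d hd
  refine ⟨by simp, ?_, ?_, ?_⟩
  · rintro i - - rfl; rfl
  · intro h; rw [hdep h]
  · intro h; rw [hdep h]
    have := VV_cap L π l p (by omega) hper φ (d + 1) l
    simp only [pW, this]
    rw [VV_ge (by omega), VV_ge le_rfl, add_mul, one_mul]
    rw [show k + 1 + d * p = l + (d * p + p) by omega]

theorem canon {S AP : Type} (L : S → Set AP) (π : ℕ → S) (k l p K : ℕ) (dep : Bool)
    (hp : p + l = k + 1) (hl : 0 < l) (hlk : l ≤ k)
    (hper : ∀ i, l ≤ i → π (i + p) = π i) (hK : K ≤ k) (hdep : dep = true → K = k)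
    (χ : PLTL AP) :
    pincC dep K L π (fun i => i = l) (fun i => l ≤ i) True (VV L π l p)
      (fun θ d => VV L π l p θ d k) (fun θ d => VV L π l p θ d l) (AX L π l p)
      (fun θ => AX L π l p θ k) χ := by
  have hp0 : 0 < p := by omega
  have last := canon_last L π k l p K dep hp hlk hper hdep
  have cV : ∀ φ d i, pV (VV L π l p) φ d i ↔ VV L π l p φ d i := fun φ d i =>
    VV_cap L π l p hp0 hper φ d i
  have cW : ∀ φ d, pW (fun θ d => VV L π l p θ d k) φ d ↔ VV L π l p φ d k := fun φ d =>
    VV_cap L π l p hp0 hper φ d k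
  have hback : ∀ d, 1 ≤ d → l + d * p - 1 = k + (d - 1) * p := by
    intro d hd
    obtain ⟨d, rfl⟩ : ∃ d', d = d' + 1 := ⟨d - 1, by omega⟩
    rw [add_mul, one_mul, Nat.add_sub_cancel]; omega
  have hVb : ∀ φ d, 1 ≤ d → (VV L π l p φ (d - 1) k ↔ PLTL.sat L π φ (l + d * p - 1)) := by
    intro φ d hd
    rw [hback d hd, VV_ge hlk]
  induction χ with
  | atom q =>
    refine ⟨fun i _ => ?_, last _⟩
    rw [VV_zero]; rfl
  | natom q =>
    refine ⟨fun i _ => ?_, last _⟩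
    rw [VV_zero]; rfl
  | conj f g hf hg =>
    refine ⟨hf, hg, fun d _ i _ => ?_, last _⟩
    rw [cV, cV, VV_conj]
  | disj f g hf hg =>
    refine ⟨hf, hg, fun d _ i _ => ?_, last _⟩
    rw [cV, cV, VV_disj]
  | next f hf =>
    refine ⟨hf, fun d _ i _ => ?_, last _⟩
    rw [cV, VV_next]
  | untl f g hf hg =>
    refine ⟨hf, hg, fun d _ i _ => ?_, last _, ?_, fun i hi _ => ?_, fun _ h => ?_, fun h => ?_⟩
    · rw [cV, cV, ← VV_untl]
    · rintro ⟨m, h1, h2, -⟩; omega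
    · simp only [AX]
      constructor
      · rintro ⟨m, h1, h2, h3⟩
        by_cases hm : m = i
        · right; rw [VV_ge (by omega), ← hm]; exact ⟨h1, h3⟩
        · left; exact ⟨m, h1, by omega, h3⟩
      · rintro (⟨m, h1, h2, h3⟩ | ⟨h1, h2⟩)
        · exact ⟨m, h1, by omega, h3⟩
        · rw [VV_ge h1] at h2; exact ⟨i, h1, le_rfl, h2⟩
    · beta_reduce at h
      rw [VV_ge hlk] at h
      obtain ⟨m, h1, h2, -⟩ := h
      have hdm := Nat.div_add_mod (m - l) p
      have hlt := Nat.mod_lt (m - l) hp0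
      have hm1 := Nat.mul_le_mul_right p (le_max_right f.delta g.delta)
      simp only [PLTL.delta] at h1
      have hQle : g.delta ≤ (m - l) / p := (Nat.le_div_iff_mul_le hp0).2 (by omega)
      rw [mul_comm] at hdm
      refine ⟨l + (m - l) % p, by omega, by omega, ?_⟩
      rw [← sat_cap L π l p hp0 hper g _ g.delta _ (by omega) le_rfl hQle,
        show l + (m - l) % p + (m - l) / p * p = m by omega]
      exact h2
    · rw [hdep h]
  | rels f g hf hg =>
    refine ⟨hf, hg, fun d _ i _ => ?_, last _, ?_, fun i hi _ => ?_, fun _ h => ?_, fun h => ?_⟩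
    · rw [cV, cV, ← VV_rels]
    · intro m h1 h2; omega
    · simp only [AX]
      constructor
      · intro h
        refine ⟨fun m a b => h m a (by omega), ?_⟩
        by_cases hi : l ≤ i
        · right; rw [VV_ge hi]; exact h i hi le_rfl
        · left; exact hi
      · rintro ⟨h1, h2⟩ m a b
        by_cases hm : m = i
        · subst hm
          have := h2.resolve_left (by omega)
          rwa [VV_ge a] at this
        · exact h1 m a (by omega)
    · beta_reduce
      rw [VV_ge hlk]
      intro m h1
      left
      have hdm := Nat.div_add_mod (m - l) p
      have hlt := Nat.mod_lt (m - l) hp0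
      have hm1 := Nat.mul_le_mul_right p (le_max_right f.delta g.delta)
      simp only [PLTL.delta] at h1
      have hQle : g.delta ≤ (m - l) / p := (Nat.le_div_iff_mul_le hp0).2 (by omega)
      rw [mul_comm] at hdm
      have := h (l + (m - l) % p) (by omega) (by omega)
      rw [← sat_cap L π l p hp0 hper g _ g.delta _ (by omega) le_rfl hQle,
        show l + (m - l) % p + (m - l) / p * p = m by omega] at this
      exact this
    · rw [hdep h]
  | prev f hf =>
    refine ⟨hf, fun d _ => ?_, fun i hi _ => ?_, fun d hd _ i hi _ => ?_, last _⟩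
    · rw [VV_lt hl]; simp [BB]
    · rw [cV, VV_zero, VV_zero]; simp only [PLTL.sat]; exact and_iff_right (by omega)
    · rw [cW, cV]
      by_cases h : i = l
      · rw [hVb _ _ hd]
        simp only [h, true_and, not_true, false_and, or_false]
        rw [VV_ge le_rfl]; simp only [PLTL.sat]; exact and_iff_right (by omega)
      · simp only [h, false_and, false_or, not_false_eq_true, true_and]
        exact VV_prev _ _ _ _ _ _ _ (by omega) h
  | wprev f hf =>
    refine ⟨hf, fun d _ => ?_, fun i hi _ => ?_, fun d hd _ i hi _ => ?_, last _⟩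
    · rw [VV_lt hl]; simp [BB]
    · rw [cV, VV_zero, VV_zero]; simp only [PLTL.sat]; exact or_iff_right (by omega)
    · rw [cW, cV]
      by_cases h : i = l
      · rw [hVb _ _ hd]
        simp only [h, true_and, not_true, false_and, or_false]
        rw [VV_ge le_rfl]; simp only [PLTL.sat]; exact or_iff_right (by omega)
      · simp only [h, false_and, false_or, not_false_eq_true, true_and]
        exact VV_wprev _ _ _ _ _ _ _ (by omega) h
  | since f g hf hg =>
    refine ⟨hf, hg, fun d _ => ?_, fun i hi _ => ?_, fun d hd _ i hi _ => ?_, last _⟩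
    · rw [cV, VV_lt hl, VV_lt hl]; simp [BB, SS]
    · rw [cV, cV, VV_zero, VV_zero, VV_zero, VV_zero, sat_since]
      have : 0 < i := by omega
      simp [this]
    · beta_reduce
      rw [cV, cV]
      by_cases h : i = l
      · rw [hVb _ _ hd]
        simp only [h, true_and, not_true, false_and, or_false]
        have : 0 < l + d * p := by omega
        rw [VV_ge le_rfl, VV_ge le_rfl, VV_ge le_rfl, sat_since]; simp [this]
      · simp only [h, false_and, false_or, not_false_eq_true, true_and]
        exact VV_since _ _ _ _ _ _ _ _ (by omega) h
  | trig f g hf hg =>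
    refine ⟨hf, hg, fun d _ => ?_, fun i hi _ => ?_, fun d hd _ i hi _ => ?_, last _⟩
    · rw [cV, VV_lt hl, VV_lt hl]; simp [BB, TT]
    · rw [cV, cV, VV_zero, VV_zero, VV_zero, VV_zero, sat_trig]
      have : ¬ i = 0 := by omega
      simp only [this, false_or]
    · beta_reduce
      rw [cV, cV]
      by_cases h : i = l
      · rw [hVb _ _ hd]
        simp only [h, true_and, not_true, false_and, or_false]
        have : ¬ l + d * p = 0 := by omega
        rw [VV_ge le_rfl, VV_ge le_rfl, VV_ge le_rfl, sat_trig]; simp only [this, false_or]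
      · simp only [h, false_and, false_or, not_false_eq_true, true_and]
        exact VV_trig _ _ _ _ _ _ _ _ (by omega) h

/-- A violated counterexample yields a simple witness. -/
theorem exists_simple {S AP : Type} [Finite S] (M : Kripke S AP) (χ : PLTL AP) (π : ℕ → S)
    (hπ : M.InitPath π) (h0 : PLTL.sat M.L π χ 0) (k : ℕ) :
    ComplSPSat M χ k ∨ ∃ i, i < k ∧ WitSPSat M χ i := by
  classical
  have hex : ∃ n, ∃ l π', Lasso M χ n l π' := lasso_exists M χ π hπ h0
  obtain ⟨l, ρ, hLas⟩ := Nat.find_spec hex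
  have hmin := fun m (hm : m < Nat.find hex) => Nat.find_min hex hm
  generalize Nat.find hex = n at hLas hmin
  have hLas' := hLas
  obtain ⟨hρ, ⟨hl0, hln, hlp, hper⟩, hs0⟩ := hLas'
  obtain ⟨p, hp⟩ : ∃ p, p = n + 1 - l := ⟨_, rfl⟩
  rw [← hp] at hper
  have hSP : ∀ K, K ≤ n → SimplePathC χ K ρ (fun i => l ≤ i) (VV M.L ρ l p) (AX M.L ρ l p) := by
    intro K hK i j hij hj
    by_contra hc
    push Not at hc
    obtain ⟨h1, h2, h3, h4⟩ := hc
    by_cases hi : l ≤ i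
    · obtain ⟨h5, h6⟩ := h4 hi (by omega)
      obtain ⟨k', hk', hh⟩ := loop_cut M χ ρ n l i j hLas hi hij (by omega) h1
        (fun φ hφ d hd => by
          have := h5 φ hφ d hd
          rwa [VV_ge hi, VV_ge (by omega), hp] at this)
        (fun f g hfg => by
          have := h6 _ hfg trivial
          simp only [AX, hp] at this
          exact this.2)
      exact hmin k' hk' hh
    · obtain ⟨k', hk', hh⟩ := stem_cut M χ ρ n l i j hLas hij (by omega) h1
        (fun φ hφ => by
          have := h3 φ hφ
          rwa [VV_zero, VV_zero] at this)
      exact hmin k' hk' hh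
  have hloop : ∀ K dep, K ≤ n → (dep = true → K = n) →
      incLoopC dep K ρ (ρ n) (fun i => i = l) (fun i => l ≤ i) True := by
    intro K dep hK hdep
    refine ⟨by omega, by omega, ?_, ?_, ?_, ?_, ?_⟩
    · rintro i - - rfl; exact hlp
    · intro i _ _; simp only; omega
    · intro i _ _; simp only; omega
    · intro h; rw [hdep h]; simp [hln]
    · intro h; rw [hdep h]
  have hmod : ∀ K, ModelC M K ρ := fun K => ⟨hρ.1, fun i hi _ => by
    have := hρ.2 (i - 1); rwa [Nat.sub_add_cancel hi] at this⟩
  by_cases hnk : n < k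
  · right
    exact ⟨n, hnk, ρ, ρ n, _, _, _, _, _, _, _, _, hmod n, hloop n true le_rfl (fun _ => rfl),
      canon M.L ρ n l p n true (by omega) hl0 hln hper le_rfl (fun _ => rfl) χ,
      (VV_zero _ _ _ _ _ _).2 hs0, hSP n le_rfl⟩
  · left
    exact ⟨ρ, ρ n, _, _, _, _, _, _, _, _, hmod k, hloop k false (by omega) (by simp),
      canon M.L ρ n l p k false (by omega) hl0 hln hper (by omega) (by simp) χ,
      (VV_zero _ _ _ _ _ _).2 hs0, hSP k (by omega)⟩

end BMC
namespace BMC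

section
variable {S AP : Type} {dep : Bool} {k : ℕ} {L : S → Set AP} {s : ℕ → S}
    {lsel inL : ℕ → Prop} {LE : Prop} {v : PLTL AP → ℕ → ℕ → Prop}
    {vE vL : PLTL AP → ℕ → Prop} {aux : PLTL AP → ℕ → Prop} {auxE : PLTL AP → Prop}

theorem pinc_sub (χ : PLTL AP) : pincC dep k L s lsel inL LE v vE vL aux auxE χ →
    ∀ φ ∈ χ.subfs, pincC dep k L s lsel inL LE v vE vL aux auxE φ := by
  induction χ with
  | atom p | natom p =>
    intro h φ hφ; simp only [PLTL.subfs, List.mem_singleton] at hφ; rw [hφ]; exact h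
  | conj f g hf hg | disj f g hf hg | untl f g hf hg | rels f g hf hg | since f g hf hg
  | trig f g hf hg =>
    intro h φ hφ
    simp only [PLTL.subfs, List.mem_cons, List.mem_append] at hφ
    rcases hφ with rfl | h' | h'
    · exact h
    · exact hf h.1 φ h'
    · exact hg h.2.1 φ h'
  | next f hf | prev f hf | wprev f hf =>
    intro h φ hφ
    simp only [PLTL.subfs, List.mem_cons] at hφ
    rcases hφ with rfl | h'
    · exact h
    · exact hf h.1 φ h'

theorem pinc_last (φ : PLTL AP) (h : pincC dep k L s lsel inL LE v vE vL aux auxE φ) :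
    incLastC dep k lsel LE v vE vL φ := by
  cases φ with
  | atom p => exact h.2
  | natom p => exact h.2
  | conj f g => exact h.2.2.2
  | disj f g => exact h.2.2.2
  | next f => exact h.2.2
  | untl f g => exact h.2.2.2.1
  | rels f g => exact h.2.2.2.1
  | prev f => exact h.2.2.2.2
  | wprev f => exact h.2.2.2.2
  | since f g => exact h.2.2.2.2.2
  | trig f g => exact h.2.2.2.2.2

theorem pV_min (f : PLTL AP) (D e i : ℕ) (h : f.delta ≤ e) :
    pV v f (min D e) i ↔ pV v f D i := by
  unfold pV
  rw [show min (min D e) f.delta = min D f.delta by omega]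

theorem pV_zero (f : PLTL AP) (i : ℕ) : pV v f 0 i ↔ v f 0 i := by
  simp [pV]

theorem sound_noloop (M : Kripke S AP) (hTot : M.Total) (χ : PLTL AP) (hLE : ¬ LE)
    (hM : ModelC M k s)
    (hP : pincC true k M.L s lsel inL LE v vE vL aux auxE χ) (h0 : v χ 0 0) :
    ∃ π, M.InitPath π ∧ PLTL.sat M.L π χ 0 := by
  choose nx hnx using hTot
  let π : ℕ → S := fun n => if n ≤ k then s n else nx^[n - k] (s k)
  have hπ1 : ∀ n, n ≤ k → π n = s n := fun n hn => by simp only [π]; rw [if_pos hn]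
  have hπ2 : ∀ r, π (k + r) = nx^[r] (s k) := fun r => by
    simp only [π]
    split_ifs with h
    · have : r = 0 := by omega
      subst this; rfl
    · rw [Nat.add_sub_cancel_left]
  refine ⟨π, ⟨?_, fun n => ?_⟩, ?_⟩
  · rw [hπ1 0 (by omega)]; exact hM.1
  · by_cases hn : n < k
    · rw [hπ1 n (by omega), hπ1 (n + 1) (by omega)]
      exact hM.2 (n + 1) (by omega) (by omega)
    · obtain ⟨r, rfl⟩ := Nat.exists_eq_add_of_le (not_lt.1 hn)
      rw [add_assoc, hπ2, hπ2, Function.iterate_succ_apply']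
      exact hnx _
  · have hE : ∀ φ ∈ χ.subfs, ¬ v φ 0 (k + 1) := by
      intro φ hφ
      have hl := pinc_last φ (pinc_sub χ hP φ hφ)
      rw [((hl 0 (by omega)).2.2.2 rfl)]
      exact (hl _ (min_le_right _ _)).1 hLE
    apply tab_sat M.L π (fun φ n => n ≤ k ∧ v φ 0 n) χ ?_ 0 ⟨by omega, h0⟩
    intro φ hφ
    have hp := pinc_sub χ hP φ hφ
    have hsub := subfs_trans χ φ hφ
    cases φ with
    | atom p =>
      rintro n ⟨hn, hv⟩
      rw [hπ1 n hn]; exact (hp.1 n hn).1 hv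
    | natom p =>
      rintro n ⟨hn, hv⟩
      rw [hπ1 n hn]; exact (hp.1 n hn).1 hv
    | conj f g =>
      rintro n ⟨hn, hv⟩
      have := (hp.2.2.1 0 (by omega) n hn).1 hv
      rw [pV_zero, pV_zero] at this
      tauto
    | disj f g =>
      rintro n ⟨hn, hv⟩
      have := (hp.2.2.1 0 (by omega) n hn).1 hv
      rw [pV_zero, pV_zero] at this
      tauto
    | next f =>
      rintro n ⟨hn, hv⟩
      have := (hp.2.1 0 (by omega) n hn).1 hv
      rw [pV_zero] at this
      refine ⟨?_, this⟩
      by_contra hc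
      have e : n = k := by omega
      rw [e] at this
      exact hE f (hsub _ (by simp [PLTL.subfs, subfs_self])) this
    | untl f g =>
      refine ⟨?_, ?_⟩
      · rintro n ⟨hn, hv⟩
        have := (hp.2.2.1 0 (by omega) n hn).1 hv
        rw [pV_zero, pV_zero] at this
        rcases this with h | ⟨h, h'⟩
        · exact Or.inl ⟨hn, h⟩
        · refine Or.inr ⟨⟨hn, h⟩, ?_, h'⟩
          by_contra hc
          have e : n = k := by omega
          rw [e] at h'
          exact hE _ hφ h'
      · intro n h
        have := (h (n + k + 1) (by omega)).1
        omega
    | rels f g =>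
      rintro n ⟨hn, hv⟩
      have := (hp.2.2.1 0 (by omega) n hn).1 hv
      rw [pV_zero, pV_zero] at this
      refine ⟨⟨hn, this.1⟩, ?_⟩
      rcases this.2 with h | h'
      · exact Or.inl ⟨hn, h⟩
      · refine Or.inr ⟨?_, h'⟩
        by_contra hc
        have e : n = k := by omega
        rw [e] at h'
        exact hE _ hφ h'
    | prev f =>
      rintro n ⟨hn, hv⟩
      have hn0 : n ≠ 0 := by
        rintro rfl
        exact hp.2.1 0 (by omega) hv
      have := (hp.2.2.1 n (by omega) hn).1 hv
      rw [pV_zero] at this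
      exact ⟨by omega, by omega, this⟩
    | wprev f =>
      rintro n ⟨hn, hv⟩
      by_cases hn0 : n = 0
      · exact Or.inl hn0
      have := (hp.2.2.1 n (by omega) hn).1 hv
      rw [pV_zero] at this
      exact Or.inr ⟨by omega, this⟩
    | since f g =>
      rintro n ⟨hn, hv⟩
      by_cases hn0 : n = 0
      · subst hn0
        have := (hp.2.2.1 0 (by omega)).1 hv
        rw [pV_zero] at this
        exact Or.inl ⟨hn, this⟩
      have := (hp.2.2.2.1 n (by omega) hn).1 hv
      rw [pV_zero, pV_zero] at this
      rcases this with h | ⟨h, h'⟩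
      · exact Or.inl ⟨hn, h⟩
      · exact Or.inr ⟨⟨hn, h⟩, by omega, by omega, h'⟩
    | trig f g =>
      rintro n ⟨hn, hv⟩
      by_cases hn0 : n = 0
      · subst hn0
        have := (hp.2.2.1 0 (by omega)).1 hv
        rw [pV_zero] at this
        exact ⟨⟨hn, this⟩, by simp⟩
      have := (hp.2.2.2.1 n (by omega) hn).1 hv
      rw [pV_zero, pV_zero] at this
      refine ⟨⟨hn, this.1⟩, ?_⟩
      rcases this.2 with h | h'
      · exact Or.inl ⟨hn, h⟩
      · exact Or.inr (Or.inr ⟨by omega, h'⟩)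

/-- (unrolling, index) pairs along the infinite unrolling of a lasso. -/
def stp (k l : ℕ) : ℕ → ℕ × ℕ
  | 0 => (0, 0)
  | n + 1 => if (stp k l n).2 = k then ((stp k l n).1 + 1, l) else
      ((stp k l n).1, (stp k l n).2 + 1)

theorem stp_le (k l : ℕ) (hlk : l ≤ k) (n : ℕ) : (stp k l n).2 ≤ k := by
  induction n with
  | zero => simp [stp]
  | succ n ih => rw [stp]; split_ifs with h <;> simp only <;> omega

theorem stp_ge (k l : ℕ) (n : ℕ) : 0 < (stp k l n).1 → l ≤ (stp k l n).2 := by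
  induction n with
  | zero => simp [stp]
  | succ n ih => rw [stp]; split_ifs with h <;> simp only <;> intro h' <;> [exact le_rfl; have := ih h'] ; omega

theorem stp_small (k l : ℕ) (n : ℕ) : n ≤ k → stp k l n = (0, n) := by
  induction n with
  | zero => intro _; rfl
  | succ n ih => intro h; rw [stp, ih (by omega)]; simp only; rw [if_neg (by omega)]

theorem stp_eq (k l p : ℕ) (hp : p + l = k + 1) (hlk : l ≤ k) (d : ℕ) :
    ∀ i, l ≤ i → i ≤ k → stp k l (i + d * p) = (d, i) := by
  induction d with
  | zero => intro i _ h; rw [zero_mul]; exact stp_small k l i h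
  | succ d ih =>
    have key : ∀ r, l + r ≤ k → stp k l (l + r + (d + 1) * p) = (d + 1, l + r) := by
      intro r
      induction r with
      | zero =>
        intro _
        rw [add_mul, one_mul, show l + 0 + (d * p + p) = k + d * p + 1 by omega, stp,
          ih k hlk le_rfl]
        simp
      | succ r ih' =>
        intro h
        rw [show l + (r + 1) + (d + 1) * p = l + r + (d + 1) * p + 1 by omega, stp,
          ih' (by omega)]
        simp only; rw [if_neg (by omega)]; rfl
    intro i h1 h2
    have := key (i - l) (by omega)
    rwa [show l + (i - l) = i by omega] at this

theorem sound_loop (M : Kripke S AP) (χ : PLTL AP) (l : ℕ) (hl : 0 < l) (hlk : l ≤ k)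
    (hLE : LE) (hls : ∀ i, 1 ≤ i → i ≤ k → (lsel i ↔ i = l))
    (hin : ∀ i, i ≤ k → (inL i ↔ l ≤ i)) (hsl : s (l - 1) = s k)
    (hM : ModelC M k s)
    (hP : pincC true k M.L s lsel inL LE v vE vL aux auxE χ) (h0 : v χ 0 0) :
    ∃ π, M.InitPath π ∧ PLTL.sat M.L π χ 0 := by
  refine ⟨fun n => s (stp k l n).2, ⟨hM.1, fun n => ?_⟩, ?_⟩
  · have hle := stp_le k l hlk n
    beta_reduce
    rw [stp]
    split_ifs with h
    · rw [h, ← hsl]; exact hM.2 l hl hlk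
    · exact hM.2 ((stp k l n).2 + 1) (by omega) (by omega)
  · apply tab_sat M.L _ (fun φ n => pV v φ (stp k l n).1 (stp k l n).2) χ ?_ 0
      (by simpa [stp, pV] using h0)
    have hstep : ∀ φ ∈ χ.subfs, ∀ n, pV v φ (stp k l n).1 ((stp k l n).2 + 1) ↔
        pV v φ (stp k l (n + 1)).1 (stp k l (n + 1)).2 := by
      intro φ hφ n
      have hlast := pinc_last φ (pinc_sub χ hP φ hφ)
      rw [stp]
      split_ifs with h
      · rw [h]
        unfold pV
        rw [(hlast _ (min_le_right _ _)).2.2.2 rfl]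
        unfold pW
        rw [(hlast _ (min_le_right _ _)).2.1 l hl hlk ((hls l hl hlk).2 rfl)]
        simp only
        rw [show min (min (stp k l n).1 φ.delta + 1) φ.delta =
          min ((stp k l n).1 + 1) φ.delta by omega]
      · rfl
    have hvE : ∀ φ ∈ χ.subfs, ∀ d, d ≤ φ.delta → (vE φ d ↔ v φ d k) := fun φ hφ d hd =>
      (pinc_last φ (pinc_sub χ hP φ hφ) d hd).2.2.1 rfl
    intro φ hφ
    have hp := pinc_sub χ hP φ hφ
    have hsub := subfs_trans χ φ hφ
    have hle := stp_le k l hlk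
    -- the case of `prev` and `wprev`
    have hprev : ∀ f ∈ χ.subfs, ∀ W : ℕ → ℕ → Prop,
        (∀ i, 1 ≤ i → i ≤ k → (W 0 i ↔ pV v f 0 (i - 1))) →
        (∀ d, 1 ≤ d → d ≤ f.delta + 1 → ∀ i, 1 ≤ i → i ≤ k →
        (W d i ↔
          ((lsel i ∧ pW vE f (d - 1)) ∨ (¬ lsel i ∧ pV v f d (i - 1))))) → ∀ n,
        W (min (stp k l (n + 1)).1 (f.delta + 1)) (stp k l (n + 1)).2 →
        pV v f (stp k l n).1 (stp k l n).2 := by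
      intro f hf W hW0 hW n
      have hlen := hle n
      have hgen := stp_ge k l n
      rw [stp]
      split_ifs with h
      · simp only
        rw [hW _ (by omega) (min_le_right _ _) l hl hlk, hls l hl hlk]
        simp only [true_and, not_true, false_and, or_false]
        unfold pW pV
        rw [hvE f hf _ (min_le_right _ _), h]
        rw [show min (min ((stp k l n).1 + 1) (f.delta + 1) - 1) f.delta =
          min (stp k l n).1 f.delta by omega]
        exact id
      · simp only
        by_cases hD : (stp k l n).1 = 0
        · rw [hD, Nat.zero_min, hW0 _ (by omega) (by omega), Nat.add_sub_cancel]
          exact id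
        · rw [hW _ (by omega) (min_le_right _ _) _ (by omega) (by omega),
            hls _ (by omega) (by omega)]
          have : ¬ ((stp k l n).2 + 1 = l) := by have := hgen (by omega); omega
          simp only [this, false_and, false_or, not_false_eq_true, true_and, Nat.add_sub_cancel]
          rw [pV_min f _ _ _ (by omega)]
          exact id
    -- the case of `since` and `trig`
    have hpast : ∀ θ ∈ χ.subfs, ∀ f g : PLTL AP, θ.delta = max f.delta g.delta + 1 →
        ∀ C : Prop → Prop → Prop → Prop,
        (∀ a b x y, C a b x → (x → y) → C a b y) →
        (∀ i, 1 ≤ i → i ≤ k → (v θ 0 i ↔ C (pV v g 0 i) (pV v f 0 i) (v θ 0 (i - 1)))) →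
        (∀ d, 1 ≤ d → d ≤ θ.delta → ∀ i, 1 ≤ i → i ≤ k →
        (v θ d i ↔ C (pV v g d i) (pV v f d i)
            ((lsel i ∧ vE θ (d - 1)) ∨ (¬ lsel i ∧ v θ d (i - 1))))) → ∀ n,
        pV v θ (stp k l (n + 1)).1 (stp k l (n + 1)).2 →
        C (pV v g (stp k l (n + 1)).1 (stp k l (n + 1)).2)
          (pV v f (stp k l (n + 1)).1 (stp k l (n + 1)).2) (pV v θ (stp k l n).1 (stp k l n).2) := by
      intro θ hθ f g hδ C hC hr0 hr n
      have hlen := hle n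
      have hgen := stp_ge k l n
      obtain ⟨μ, hμ⟩ : ∃ μ, μ = max f.delta g.delta := ⟨_, rfl⟩
      rw [← hμ] at hδ
      have hfg : ∀ i, (pV v f (μ + 1) i ↔ pV v f μ i) ∧ (pV v g (μ + 1) i ↔ pV v g μ i) := by
        intro i
        unfold pV
        rw [show min (μ + 1) f.delta = min μ f.delta by omega,
          show min (μ + 1) g.delta = min μ g.delta by omega]
        exact ⟨Iff.rfl, Iff.rfl⟩
      have hstab : v θ μ k → v θ (μ + 1) k := by
        intro hk
        have key : ∀ r, l + r ≤ k → v θ μ (l + r) → v θ (μ + 1) (l + r) := by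
          intro r
          induction r with
          | zero =>
            intro hr' hv
            rw [add_zero] at *
            rw [hr (μ + 1) (by omega) (by omega) l hl hlk, (hfg l).1, (hfg l).2]
            have ht : (lsel l ∧ vE θ (μ + 1 - 1)) ∨ (¬ lsel l ∧ v θ (μ + 1) (l - 1)) := by
              left
              refine ⟨(hls l hl hlk).2 rfl, ?_⟩
              rw [Nat.add_sub_cancel, hvE θ hθ μ (by omega)]; exact hk
            by_cases hm : μ = 0
            · rw [hm, hr0 l hl hlk, ← hm] at hv
              exact hC _ _ _ _ hv (fun _ => ht)
            · rw [hr μ (by omega) (by omega) l hl hlk] at hv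
              exact hC _ _ _ _ hv (fun _ => ht)
          | succ r ih =>
            intro hr' hv
            have ih := ih (by omega)
            have hnl : ¬ lsel (l + (r + 1)) := by
              rw [hls _ (by omega) hr']; omega
            rw [hr (μ + 1) (by omega) (by omega) _ (by omega) hr', (hfg _).1, (hfg _).2]
            simp only [hnl, false_and, false_or, not_false_eq_true, true_and]
            rw [show l + (r + 1) - 1 = l + r by omega]
            by_cases hm : μ = 0
            · rw [hm, hr0 _ (by omega) hr', ← hm, show l + (r + 1) - 1 = l + r by omega] at hv
              exact hC _ _ _ _ hv ih
            · rw [hr μ (by omega) (by omega) _ (by omega) hr'] at hv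
              simp only [hnl, false_and, false_or, not_false_eq_true, true_and] at hv
              rw [show l + (r + 1) - 1 = l + r by omega] at hv
              exact hC _ _ _ _ hv ih
        have := key (k - l) (by omega)
        rw [show l + (k - l) = k by omega] at this
        exact this hk
      have hmf : ∀ D i, pV v f (min D θ.delta) i ↔ pV v f D i := fun D i =>
        pV_min f D _ i (by omega)
      have hmg : ∀ D i, pV v g (min D θ.delta) i ↔ pV v g D i := fun D i =>
        pV_min g D _ i (by omega)
      rw [stp]
      split_ifs with h
      · simp only
        intro hv
        rw [pV, hr _ (by omega) (min_le_right _ _) l hl hlk, hmf, hmg, hls l hl hlk] at hv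
        simp only [true_and, not_true, false_and, or_false] at hv
        apply hC _ _ _ _ hv
        rw [hvE θ hθ _ (by omega), h]
        unfold pV
        by_cases hD : (stp k l n).1 + 1 ≤ θ.delta
        · rw [show min ((stp k l n).1 + 1) θ.delta - 1 = min (stp k l n).1 θ.delta by omega]
          exact id
        · rw [show min ((stp k l n).1 + 1) θ.delta - 1 = μ by omega,
            show min (stp k l n).1 θ.delta = μ + 1 by omega]
          exact hstab
      · simp only
        intro hv
        by_cases hD : (stp k l n).1 = 0
        · rw [hD] at hv ⊢
          rw [pV_zero, hr0 _ (by omega) (by omega), Nat.add_sub_cancel] at hv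
          rw [pV_zero θ]
          exact hv
        · have hnl : ¬ lsel ((stp k l n).2 + 1) := by
            rw [hls _ (by omega) (by omega)]
            have := hgen (by omega); omega
          rw [pV, hr _ (by omega) (min_le_right _ _) _ (by omega) (by omega), hmf, hmg] at hv
          simp only [hnl, false_and, false_or, not_false_eq_true, true_and,
            Nat.add_sub_cancel] at hv
          exact hv
    cases φ with
    | atom p =>
      intro n hv
      exact (hp.1 _ (hle n)).1 (by simpa [pV, PLTL.delta] using hv)
    | natom p =>
      intro n hv
      exact (hp.1 _ (hle n)).1 (by simpa [pV, PLTL.delta] using hv)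
    | conj f g =>
      intro n hv
      have := (hp.2.2.1 _ (min_le_right _ _) _ (hle n)).1 hv
      rwa [pV_min f _ _ _ (by simp [PLTL.delta]), pV_min g _ _ _ (by simp [PLTL.delta])] at this
    | disj f g =>
      intro n hv
      have := (hp.2.2.1 _ (min_le_right _ _) _ (hle n)).1 hv
      rwa [pV_min f _ _ _ (by simp [PLTL.delta]), pV_min g _ _ _ (by simp [PLTL.delta])] at this
    | next f =>
      intro n hv
      have := (hp.2.1 _ (min_le_right _ _) _ (hle n)).1 hv
      rw [pV_min f _ _ _ (by simp [PLTL.delta])] at this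
      exact (hstep f (hsub _ (by simp [PLTL.subfs, subfs_self])) n).1 this
    | untl f g =>
      refine ⟨?_, ?_⟩
      · intro n hv
        have := (hp.2.2.1 _ (min_le_right _ _) _ (hle n)).1 hv
        rw [pV_min f _ _ _ (by simp [PLTL.delta]), pV_min g _ _ _ (by simp [PLTL.delta])] at this
        exact this.imp id (And.imp id (hstep _ hφ n).1)
      · intro n hall
        obtain ⟨p, hpk⟩ : ∃ p, p + l = k + 1 := ⟨k + 1 - l, by omega⟩
        have hp0 : 0 < p := by omega
        obtain ⟨Q, hQ⟩ : ∃ Q, Q = n + (PLTL.untl f g).delta := ⟨_, rfl⟩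
        have hQp : Q ≤ Q * p := Nat.le_mul_of_pos_right Q hp0
        have h1 := hall (k + Q * p) (by omega)
        simp only [stp_eq k l p hpk hlk Q k hlk le_rfl] at h1
        rw [pV, min_eq_right (by omega), ← hvE _ hφ _ le_rfl] at h1
        have h2 := hp.2.2.2.2.2.2.1 hLE h1
        rw [hp.2.2.2.2.2.2.2 rfl] at h2
        have hax : ∀ i, i ≤ k → aux (.untl f g) i → ∃ j, l ≤ j ∧ j ≤ i ∧ v g g.delta j := by
          intro i
          induction i with
          | zero => intro _ h; exact absurd h hp.2.2.2.2.1
          | succ i ih =>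
            intro hi h
            rw [hp.2.2.2.2.2.1 (i + 1) (by omega) hi, Nat.add_sub_cancel] at h
            rcases h with h | ⟨h, h'⟩
            · obtain ⟨j, a, b, c⟩ := ih (by omega) h
              exact ⟨j, a, by omega, c⟩
            · exact ⟨i + 1, (hin _ hi).1 h, le_rfl, h'⟩
        obtain ⟨j, a, b, c⟩ := hax k le_rfl h2
        refine ⟨j + Q * p, by omega, ?_⟩
        simp only [stp_eq k l p hpk hlk Q j a b]
        simp only [PLTL.delta] at hQ
        rw [pV, min_eq_right (by omega)]
        exact c
    | rels f g =>
      intro n hv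
      have := (hp.2.2.1 _ (min_le_right _ _) _ (hle n)).1 hv
      rw [pV_min f _ _ _ (by simp [PLTL.delta]), pV_min g _ _ _ (by simp [PLTL.delta])] at this
      exact this.imp id (Or.imp id (hstep _ hφ n).1)
    | prev f =>
      intro n hv
      cases n with
      | zero => exact absurd hv (hp.2.1 _ (min_le_right _ _))
      | succ n =>
        exact ⟨by omega, hprev f (hsub _ (by simp [PLTL.subfs, subfs_self])) (v (.prev f))
          hp.2.2.1 hp.2.2.2.1 n hv⟩
    | wprev f =>
      intro n hv
      cases n with
      | zero => exact Or.inl rfl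
      | succ n =>
        exact Or.inr (hprev f (hsub _ (by simp [PLTL.subfs, subfs_self])) (v (.wprev f))
          hp.2.2.1 hp.2.2.2.1 n hv)
    | since f g =>
      intro n hv
      cases n with
      | zero =>
        have := (hp.2.2.1 _ (min_le_right _ _)).1 hv
        rw [pV_min g _ _ _ (by simp only [PLTL.delta]; omega)] at this
        exact Or.inl this
      | succ n =>
        have := hpast _ hφ f g rfl (fun a b x => a ∨ (b ∧ x)) (fun a b x y => by tauto)
          hp.2.2.2.1 hp.2.2.2.2.1 n hv
        exact this.imp id (And.imp id (fun h => ⟨by omega, h⟩))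
    | trig f g =>
      intro n hv
      cases n with
      | zero =>
        have := (hp.2.2.1 _ (min_le_right _ _)).1 hv
        rw [pV_min g _ _ _ (by simp only [PLTL.delta]; omega)] at this
        exact ⟨this, Or.inr (Or.inl rfl)⟩
      | succ n =>
        have := hpast _ hφ f g rfl (fun a b x => a ∧ (b ∨ x)) (fun a b x y => by tauto)
          hp.2.2.2.1 hp.2.2.2.2.1 n hv
        exact this.imp id (Or.imp id Or.inr)

end

theorem sound {S AP : Type} (M : Kripke S AP) (hTot : M.Total) (χ : PLTL AP) (k : ℕ)
    (h : WitSPSat M χ k) : ∃ π, M.InitPath π ∧ PLTL.sat M.L π χ 0 := by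
  obtain ⟨s, sE, lsel, inL, LE, v, vE, vL, aux, auxE, hM, hL, hP, h0, -⟩ := h
  by_cases hLE : LE
  · obtain ⟨a1, a2, a3, a4, a5, a6, a7⟩ := hL
    have hink : inL k := (a6 rfl).1 hLE
    have hex : ∀ i, i ≤ k → inL i → ∃ l, 1 ≤ l ∧ l ≤ i ∧ lsel l := by
      intro i
      induction i with
      | zero => intro _ h; exact absurd h a2
      | succ i ih =>
        intro hi h
        rw [a4 (i + 1) (by omega) hi, Nat.add_sub_cancel] at h
        rcases h with h | h
        · obtain ⟨l, a, b, c⟩ := ih (by omega) h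
          exact ⟨l, a, by omega, c⟩
        · exact ⟨i + 1, by omega, le_rfl, h⟩
    have hmono : ∀ l, 1 ≤ l → lsel l → ∀ r, l + r ≤ k → inL (l + r) := by
      intro l hl hs r
      induction r with
      | zero => intro h; exact (a4 l hl h).2 (Or.inr hs)
      | succ r ih =>
        intro h
        exact (a4 _ (by omega) h).2 (Or.inl (ih (by omega)))
    have huniq : ∀ i j, 1 ≤ i → i < j → j ≤ k → lsel i → ¬ lsel j := by
      intro i j hi hij hj h
      apply a5 j (by omega) hj
      have := hmono i hi h (j - 1 - i) (by omega)
      rwa [show i + (j - 1 - i) = j - 1 by omega] at this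
    obtain ⟨l, hl, hlk, hsel⟩ := hex k le_rfl hink
    refine sound_loop M χ l hl hlk hLE ?_ ?_ ?_ hM hP h0
    · intro i h1 h2
      constructor
      · intro h
        by_contra hne
        rcases Nat.lt_or_gt_of_ne hne with h' | h'
        · exact huniq i l h1 h' hlk h hsel
        · exact huniq l i hl h' h2 hsel h
      · rintro rfl; exact hsel
    · intro i hi
      constructor
      · intro h
        obtain ⟨l', b1, b2, b3⟩ := hex i hi h
        by_contra hc
        exact huniq l' l b1 (by omega) hlk b3 hsel
      · intro h
        have := hmono l hl hsel (i - l) (by omega)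
        rwa [show l + (i - l) = i by omega] at this
    · rw [a3 l hl hlk hsel, a7 rfl]
  · exact sound_noloop M hTot χ hLE hM hP h0

theorem simple_bound {S AP : Type} [Finite S] (χ : PLTL AP) : ∃ k, ∀ (s : ℕ → S) (inL : ℕ → Prop)
    (v : PLTL AP → ℕ → ℕ → Prop) (aux : PLTL AP → ℕ → Prop), ¬ SimplePathC χ k s inL v aux := by
  classical
  have : Finite {φ // φ ∈ χ.subfs} := (List.finite_toSet χ.subfs).to_subtype
  let T := S × Prop × ((Σ φ : {φ // φ ∈ χ.subfs}, Fin (φ.1.delta + 1)) → Prop) ×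
    ({φ // φ ∈ χ.subfs} → Prop)
  refine ⟨Nat.card T, fun s inL v aux hSP => ?_⟩
  let F : Fin (Nat.card T + 1) → T := fun i =>
    (s i, inL i, fun x => v x.1.1 x.2 i, fun x => aux x.1 i)
  have hF : ∀ i j, i < j → F i ≠ F j := by
    intro i j hij heq
    have e1 : s i = s j := congrArg (fun t : T => t.1) heq
    have e2 : inL i = inL j := congrArg (fun t : T => t.2.1) heq
    have e3 := congrArg (fun t : T => t.2.2.1) heq
    have e4 := congrArg (fun t : T => t.2.2.2) heq
    have hv : ∀ φ ∈ χ.subfs, ∀ d, d ≤ φ.delta → (v φ d i ↔ v φ d j) := fun φ hφ d hd =>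
      iff_of_eq (congrFun e3 ⟨⟨φ, hφ⟩, ⟨d, by simp only; omega⟩⟩)
    rcases hSP i j hij (by omega) with h | h | ⟨φ, hφ, h⟩ | ⟨-, -, ⟨φ, hφ, d, hd, h⟩ | ⟨φ, hφ, -, h⟩⟩
    · exact h e1
    · exact h (iff_of_eq e2)
    · exact h (hv φ hφ 0 (by omega))
    · exact h (hv φ hφ d hd)
    · exact h (iff_of_eq (congrFun e4 ⟨φ, hφ⟩))
  have hinj : Function.Injective F := by
    intro i j h
    by_contra hne
    rcases lt_or_gt_of_ne hne with h' | h'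
    · exact hF i j h' h
    · exact hF j i h' h.symm
  have := Nat.card_le_card_of_injective F hinj
  rw [Nat.card_fin] at this
  omega

end BMC
open BMC in
/-- Theorem (completeness of incremental BMC): `M ⊨ ψ` iff for some `k ≥ 0`
the completeness formula conjoined with the simple path formula
`⟦⟦M,¬ψ,k⟧⟧ ∧ ⟦SimplePath⟧_k` is unsatisfiable and the witness formula
conjoined with the simple path formula `⟦M,¬ψ,i⟧ ∧ ⟦SimplePath⟧_i` is
unsatisfiable for all `0 ≤ i < k`. -/
theorem bmc_completeness {S AP : Type} [Finite S]
    (M : Kripke S AP) (hTot : M.Total) (ψ : PLTL AP) :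
    M.Models ψ ↔
    ∃ k : ℕ, ¬ ComplSPSat M ψ.neg k ∧ ∀ i, i < k → ¬ WitSPSat M ψ.neg i := by
  constructor
  · intro h
    obtain ⟨k, hk⟩ := simple_bound (S := S) ψ.neg
    refine ⟨k, ?_, ?_⟩
    · rintro ⟨s, _, _, inL, _, v, _, _, aux, _, _, _, _, _, hSP⟩
      exact hk s inL v aux hSP
    · intro i _ hw
      obtain ⟨π, hπ, hs⟩ := sound M hTot _ i hw
      exact (sat_neg M.L π ψ 0).1 hs (h π hπ)
  · rintro ⟨k, h1, h2⟩ π hπ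
    by_contra hc
    rcases exists_simple M ψ.neg π hπ ((sat_neg M.L π ψ 0).2 hc) k with h | ⟨i, hi, h⟩
    · exact h1 h
    · exact h2 i hi h
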